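/- arXiv:2007.10881 — 6 statements merged into one kernel-verified Lean document; each statement's English description precedes it below -/
import Mathlib

section
/- For every nonnegative integer n and for i = 1 or i = 2, the number P_{2,i}(n) of partitions of n with at most i-1 parts equal to 1, in which every even part is at least 2m (where m is the total number of parts of the partition), and in which the odd parts, listed in decreasing order λ_{j_1} ≥ λ_{j_2} ≥ ..., satisfy λ_{j_ℓ} - λ_{j_{ℓ+2}} ≥ 4 for every valid index ℓ, equals the number B_{2,i}(n) of partitions of n in which any two parts differ by at least 2 (no equal and no consecutive parts) and at most i-1 parts are equal to 1. -/
/-!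
Formalization of statements from "Even-Odd partition identities of
Rogers-Ramanujan type" (P. Afsharijoo).

A partition of `n` is modelled by Mathlib's `Nat.Partition n` (a multiset of
positive parts summing to `n`).  Sorted-in-increasing-order lists of parts are
used to express the conditions on consecutive parts of the decreasing
enumeration `λ_1 ≥ λ_2 ≥ …`.
-/

/-- The parts of a partition, sorted in increasing order. -/
def Nat.Partition.sortedParts {n : ℕ} (p : n.Partition) : List ℕ :=
  p.parts.sort (· ≤ ·)

/-- The odd parts of a partition, sorted in increasing order. -/
def Nat.Partition.oddParts {n : ℕ} (p : n.Partition) : List ℕ :=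
  (p.parts.filter (fun x => ¬ Even x)).sort (· ≤ ·)

/-- The even parts of a partition, sorted in increasing order. -/
def Nat.Partition.evenParts {n : ℕ} (p : n.Partition) : List ℕ :=
  (p.parts.filter (fun x => Even x)).sort (· ≤ ·)

/-- `GapCond L d g` : any two entries of `L` lying `d` positions apart differ by at
least `g`.  When `L` lists parts in increasing order, this says that the
corresponding decreasing enumeration `λ_1 ≥ λ_2 ≥ …` satisfies
`λ_ℓ - λ_{ℓ+d} ≥ g` for every valid index `ℓ`.
In particular `GapCond p.sortedParts 1 2` says that any two parts of `p`
differ by at least `2` (no equal and no consecutive parts), and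
`GapCond p.oddParts 2 4` says that the odd parts satisfy
`λ_{j_ℓ} - λ_{j_{ℓ+2}} ≥ 4`. -/
def GapCond (L : List ℕ) (d g : ℕ) : Prop :=
  ∀ ℓ : ℕ, ℓ + d < L.length → g ≤ L[ℓ + d]! - L[ℓ]!

open PowerSeries in
/-- If the families `O₀, O₁, O₂` and `B₀, B₁` satisfy the recurrences obtained by removing the
smallest part, and `u n = 1 / ((1 - q²) ⋯ (1 - q²ⁿ))`, then `B₀` and `B₁` are the sums of the
`O`s weighted by `q ^ (2mk) * u k`. -/
theorem sum_eq_of_rogersRamanujan_recurrences {R : Type*} [CommRing R] [IsDomain R]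
    (q : R) (hq : ∀ n, q ^ (n + 1) ≠ 1)
    (u O₀ O₁ O₂ B₀ B₁ : ℕ → R) (u_zero : u 0 = 1)
    (u_succ : ∀ n, u (n + 1) = u n + q ^ (2 * (n + 1)) * u (n + 1))
    (hO₀ : ∀ r, O₀ r = q ^ (2 * r) * O₂ r)
    (hO₁_zero : O₁ 0 = 1) (hO₁ : ∀ r, O₁ (r + 1) = O₀ (r + 1) + q ^ (2 * r + 1) * O₁ r)
    (hO₂_zero : O₂ 0 = 1) (hO₂_one : O₂ 1 = O₁ 1)
    (hO₂ : ∀ r, O₂ (r + 2) = O₁ (r + 2) + q ^ (2 * r + 2) * O₀ r)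
    (hB₀ : ∀ m, B₀ m = q ^ m * B₁ m)
    (hB₁_zero : B₁ 0 = 1) (hB₁ : ∀ m, B₁ (m + 1) = B₀ (m + 1) + q ^ (m + 1) * B₀ m) (m : ℕ) :
    ∑ x ∈ Finset.HasAntidiagonal.antidiagonal m, q ^ (2 * m * x.1) * u x.1 * O₀ x.2 = B₀ m ∧
    ∑ x ∈ Finset.HasAntidiagonal.antidiagonal m, q ^ (2 * m * x.1) * u x.1 * O₁ x.2 = B₁ m := by
  set A : R⟦X⟧ := PowerSeries.mk fun a => q ^ (a * (a - 1)) * u a with hA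
  set C : R⟦X⟧ := PowerSeries.mk fun n => if Even n then u (n / 2) else 0 with hC
  have A_eq : rescale q (rescale q A) * (1 + X) = A := by
    ext n
    rcases n with _ | n
    · simp [hA, mul_add]
      simp [← coeff_zero_eq_constantCoeff_apply, coeff_rescale]
    · rw [mul_add, mul_one, map_add, coeff_succ_mul_X]
      simp only [coeff_rescale, hA, coeff_mk, Nat.add_sub_cancel]
      rcases n with _ | n
      · have := u_succ 0
        simp only [zero_add] at this ⊢
        simp only [mul_one, one_mul, pow_zero, pow_one, zero_mul, mul_zero] at this ⊢
        linear_combination -this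
      · have := u_succ (n + 1)
        simp only [Nat.add_sub_cancel]
        linear_combination -(q ^ ((n + 1 + 1) * (n + 1))) * this
  have C_eq : rescale q C = C * (1 - X ^ 2) := by
    ext n
    rw [mul_sub, mul_one, map_sub, coeff_rescale, coeff_mul_X_pow']
    simp only [hC, coeff_mk]
    rcases n with _ | _ | n
    · simp
    · simp
    · simp only [add_assoc, one_add_one_eq_two, Nat.le_add_left, if_true, Nat.add_sub_cancel,
        Nat.even_add, even_two, iff_true]
      split_ifs with h
      · obtain ⟨k, rfl⟩ := h
        have h1 : (k + k + 2) / 2 = k + 1 := by omega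
        have h2 : (k + k) / 2 = k := by omega
        have := u_succ k
        rw [h1, h2]
        linear_combination -this
      · simp
  have A_zero : coeff 0 A = 1 := by simp [hA, u_zero]
  have C_zero : coeff 0 C = 1 := by simp [hC, u_zero]
  set Y := rescale q A * C with hY
  set V := A * C with hV
  have Y_eq : rescale q Y = V * (1 - X) := by
    rw [hY, hV, map_mul, C_eq]
    linear_combination C * (1 - X) * A_eq
  have V_eq : rescale q V = Y * (1 - X ^ 2) := by
    rw [hY, hV, map_mul, C_eq]; ring
  set W := rescale q A * V with hW
  have W_eq : rescale q W = W * (1 - X) := by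
    rw [hW, map_mul, V_eq, hY, hV]
    linear_combination rescale q A * C * (1 - X) * A_eq
  have V_zero : coeff 0 V = 1 := by
    rw [coeff_zero_eq_constantCoeff] at *; simp [hV, A_zero, C_zero]
  have Y_zero : coeff 0 Y = 1 := by
    have := coeff_rescale A q 0
    rw [coeff_zero_eq_constantCoeff] at *; simp [hY, this, A_zero, C_zero]
  have W_zero : coeff 0 W = 1 := by
    have := coeff_rescale A q 0
    rw [coeff_zero_eq_constantCoeff] at *; simp [hW, this, A_zero, V_zero]
  have Y_succ (n : ℕ) : q ^ (n + 1) * coeff (n + 1) Y = coeff (n + 1) V - coeff n V := by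
    rw [← coeff_rescale, Y_eq, mul_sub, mul_one, map_sub, coeff_succ_mul_X]
  have W_succ (n : ℕ) : q ^ (n + 1) * coeff (n + 1) W = coeff (n + 1) W - coeff n W := by
    rw [← coeff_rescale, W_eq, mul_sub, mul_one, map_sub, coeff_succ_mul_X]
  have V_succ (n : ℕ) : q ^ (n + 2) * coeff (n + 2) V = coeff (n + 2) Y - coeff n Y := by
    rw [← coeff_rescale, V_eq, mul_sub, mul_one, map_sub, coeff_mul_X_pow]
  have V_one : q * coeff 1 V = coeff 1 Y := by
    have := coeff_rescale V q 1
    rw [V_eq, mul_sub, mul_one, map_sub, coeff_mul_X_pow'] at this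
    simpa using this.symm
  have B_eq (m : ℕ) : B₁ m = q ^ (m * m) * coeff m W := by
    induction m with
    | zero => simp [hB₁_zero, W_zero]
    | succ m ih =>
      have h := hB₁ m
      rw [hB₀, hB₀, ih] at h
      apply mul_left_cancel₀ (sub_ne_zero.2 (hq m).symm)
      linear_combination h + q ^ ((m + 1) * (m + 1)) * W_succ m
  have O_eq (r : ℕ) : (O₁ r = q ^ (r * r) * coeff r V ∧ O₂ r = q ^ (r * (r - 1)) * coeff r Y) ∧
      (O₁ (r + 1) = q ^ ((r + 1) * (r + 1)) * coeff (r + 1) V ∧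
        O₂ (r + 1) = q ^ ((r + 1) * r) * coeff (r + 1) Y) := by
    induction r with
    | zero =>
      refine ⟨by simp [hO₁_zero, hO₂_zero, V_zero, Y_zero], ?_⟩
      have h := hO₁ 0
      have hY1 := Y_succ 0
      simp only [zero_add, mul_one, mul_zero, pow_one, pow_zero, one_mul] at *
      rw [hO₀, ← hO₂_one, hO₁_zero] at h
      rw [V_zero] at hY1
      have h2 : O₂ 1 = coeff 1 Y := by
        apply mul_left_cancel₀ (sub_ne_zero.2 (hq 1).symm)
        linear_combination h + q * hY1 + V_one
      exact ⟨by rw [← hO₂_one, h2, V_one], h2⟩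
    | succ r ih =>
      refine ⟨by simpa using ih.2, ?_⟩
      obtain ⟨⟨-, h1⟩, h2, -⟩ := ih
      have e1 := hO₁ (r + 1)
      have e2 := hO₂ r
      have e3 := Y_succ (r + 1)
      have e4 := V_succ r
      have h1' : q ^ (2 * r) * O₂ r = q ^ (r * r + r) * coeff r Y := by
        rw [h1]
        rcases r with _ | r
        · simp
        · simp only [Nat.add_sub_cancel]; ring
      rw [hO₀, h1'] at e2
      rw [hO₀, h2] at e1
      have key : O₂ (r + 1 + 1) = q ^ ((r + 1 + 1) * (r + 1)) * coeff (r + 1 + 1) Y := by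
        apply mul_left_cancel₀ (sub_ne_zero.2 (hq (2 * r + 3)).symm)
        linear_combination e2 + e1 + q ^ ((r + 2) * (r + 2)) * e3 + q ^ ((r + 2) * (r + 1)) * e4
      refine ⟨?_, key⟩
      rw [key] at e1
      linear_combination e1 + q ^ ((r + 2) * (r + 2)) * e3
  have A_coeff (k : ℕ) : coeff k (rescale q A) = q ^ (k * k) * u k := by
    rw [coeff_rescale, hA, coeff_mk]
    rcases k with _ | k
    · simp
    · simp only [Nat.add_sub_cancel]; ring
  constructor
  · have hO₀_eq (r : ℕ) : O₀ r = q ^ (r * r) * coeff r (rescale q Y) := by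
      rw [hO₀, (O_eq r).1.2, coeff_rescale]
      rcases r with _ | r
      · simp
      · simp only [Nat.add_sub_cancel]; ring
    have h : rescale q W = rescale q A * rescale q Y := by
      rw [hW, ← map_mul, hY, hV]
      congr 1
      ring
    rw [hB₀, B_eq, mul_left_comm, ← coeff_rescale, h, coeff_mul, Finset.mul_sum]
    refine Finset.sum_congr rfl fun x hx => ?_
    obtain rfl := Finset.HasAntidiagonal.mem_antidiagonal.1 hx
    rw [A_coeff, hO₀_eq]
    ring
  · rw [B_eq, hW, coeff_mul, Finset.mul_sum]
    refine Finset.sum_congr rfl fun x hx => ?_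
    obtain rfl := Finset.HasAntidiagonal.mem_antidiagonal.1 hx
    rw [A_coeff, (O_eq _).1.1]
    ring

theorem List.count_add_count_le_length {x y : ℕ} (h : x ≠ y) (l : List ℕ) :
    l.count x + l.count y ≤ l.length := by
  induction l with
  | nil => simp
  | cons a l ih => simp only [List.count_cons, List.length_cons, beq_iff_eq]; grind

theorem List.count_add_count_eq_length {x y : ℕ} (h : x ≠ y) {l : List ℕ}
    (hl : ∀ a ∈ l, a = x ∨ a = y) : l.count x + l.count y = l.length := by
  induction l with
  | nil => simp
  | cons a l ih =>
    have := ih fun b hb => hl b (List.mem_cons_of_mem _ hb)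
    have := hl a List.mem_cons_self
    simp only [List.count_cons, List.length_cons, beq_iff_eq]
    grind

theorem gapCond_cons {a d g : ℕ} {l : List ℕ} :
    GapCond (a :: l) (d + 1) g ↔ (d < l.length → g ≤ l[d]! - a) ∧ GapCond l (d + 1) g := by
  constructor
  · refine fun h => ⟨fun hd => ?_, fun ℓ hℓ => ?_⟩
    · simpa using h 0 (by simpa using hd)
    · have := h (ℓ + 1) (by simp only [List.length_cons]; omega)
      rwa [show ℓ + 1 + (d + 1) = ℓ + (d + 1) + 1 by omega] at this
  · rintro ⟨h0, h⟩ (_ | ℓ) hℓ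
    · simpa using h0 (by simpa using hℓ)
    · have := h ℓ (by simp only [List.length_cons] at hℓ; omega)
      rwa [show ℓ + 1 + (d + 1) = ℓ + (d + 1) + 1 by omega]

theorem gapCond_iff_count_add_count_le {c d : ℕ} (hc : 0 < c) {l : List ℕ}
    (hl : l.Pairwise (· ≤ ·)) (hmod : ∀ x ∈ l, ∃ y, x = 1 + c * y) :
    GapCond l (d + 1) (2 * c) ↔ ∀ x, l.count x + l.count (x + c) ≤ d + 1 := by
  induction l with
  | nil => simp [GapCond]
  | cons a l ih =>
    rw [List.pairwise_cons] at hl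
    rw [gapCond_cons, ih hl.2 fun x hx => hmod x (List.mem_cons_of_mem _ hx)]
    constructor
    · rintro ⟨hd, h⟩ x
      by_cases hx : a = x ∨ a = x + c
      · have hdrop : ∀ y ∈ l.drop d, x + c < y := by
          intro y hy
          have hlen : d < l.length := by
            by_contra hlen
            simp [List.drop_eq_nil_of_le (not_lt.1 hlen)] at hy
          have h1 := hd hlen
          rw [getElem!_pos l d hlen] at h1
          have h2 : l[d] ≤ y := by
            obtain ⟨i, hi, rfl⟩ := List.mem_iff_getElem.1 hy
            rw [List.getElem_drop]
            exact hl.2.sortedLE.getElem_le_getElem_of_le (by omega)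
          omega
        have h1 : (l.drop d).count x = 0 :=
          List.count_eq_zero.2 fun hx => by have := hdrop x hx; omega
        have h2 : (l.drop d).count (x + c) = 0 :=
          List.count_eq_zero.2 fun hx => by have := hdrop _ hx; omega
        have h3 := List.count_add_count_le_length (x := x) (y := x + c) (by omega) (l.take d)
        have h4 : l.count x = (l.take d).count x := by
          conv_lhs => rw [← List.take_append_drop d l, List.count_append, h1, add_zero]
        have h5 : l.count (x + c) = (l.take d).count (x + c) := by
          conv_lhs => rw [← List.take_append_drop d l, List.count_append, h2, add_zero]
        have h6 := List.length_take_le d l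
        simp only [List.count_cons, beq_iff_eq]
        split_ifs <;> omega
      · push Not at hx
        rw [List.count_cons_of_ne hx.1, List.count_cons_of_ne hx.2]
        exact h x
    · refine fun h => ⟨fun hd => ?_, fun x => ?_⟩
      · by_contra hlt
        rw [getElem!_pos l d hd] at hlt
        have hall : ∀ y ∈ l.take (d + 1), y = a ∨ y = a + c := by
          intro y hy
          have hyl := List.mem_of_mem_take hy
          have h1 := hl.1 y hyl
          have h2 : y ≤ l[d] := by
            obtain ⟨i, hi, rfl⟩ := List.mem_iff_getElem.1 hy
            rw [List.getElem_take]
            rw [List.length_take] at hi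
            exact hl.2.sortedLE.getElem_le_getElem_of_le (by omega)
          obtain ⟨u, rfl⟩ := hmod y (List.mem_cons_of_mem _ hyl)
          obtain ⟨v, rfl⟩ := hmod a List.mem_cons_self
          have h3 : v ≤ u := Nat.le_of_mul_le_mul_left (by omega) hc
          have h4 : u < v + 2 := Nat.lt_of_mul_lt_mul_left (a := c) (by rw [mul_add]; omega)
          obtain rfl | rfl : u = v ∨ u = v + 1 := by omega
          · exact .inl rfl
          · right; ring
        have h1 := List.count_add_count_eq_length (by omega) hall
        have h2 := (List.take_sublist (d + 1) l).count_le a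
        have h3 := (List.take_sublist (d + 1) l).count_le (a + c)
        have h4 := h a
        simp only [List.count_cons_self] at h4
        rw [List.count_cons_of_ne (by omega)] at h4
        rw [List.length_take] at h1
        omega
      · exact (Nat.add_le_add List.count_le_count_cons List.count_le_count_cons).trans (h x)

/-- The generating function, by sum, of the multisets of size `m` satisfying `Q`. -/
noncomputable def multisetGF (Q : Multiset ℕ → Prop) (m : ℕ) : PowerSeries ℚ :=
  PowerSeries.mk fun n => ({s : Multiset ℕ | (s.card = m ∧ s.sum = n) ∧ Q s}.ncard : ℚ)

theorem finite_multiset_card_sum (m n : ℕ) (Q : Multiset ℕ → Prop) :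
    {s : Multiset ℕ | (s.card = m ∧ s.sum = n) ∧ Q s}.Finite := by
  refine (Set.finite_Iic (m • (Multiset.range (n + 1)))).subset ?_
  rintro s ⟨⟨hm, hn⟩, -⟩
  rw [Set.mem_Iic, Multiset.le_iff_count]
  intro a
  by_cases ha : a ∈ s
  · have h1 : a ≤ n := hn ▸ Multiset.le_sum_of_mem ha
    have h2 : 1 ≤ (Multiset.range (n + 1)).count a :=
      Multiset.one_le_count_iff_mem.2 (Multiset.mem_range.2 (by omega))
    rw [Multiset.count_nsmul]
    calc s.count a ≤ m := hm ▸ Multiset.count_le_card a s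
      _ ≤ _ := Nat.le_mul_of_pos_right _ h2
  · simp [Multiset.count_eq_zero_of_notMem ha]

theorem Set.Finite.ncard_eq_sum_ncard_fiber {α : Type*} {S : Set α} (hS : S.Finite) (f : α → ℕ)
    {N : ℕ} (hf : ∀ a ∈ S, f a < N) :
    S.ncard = ∑ k ∈ Finset.range N, {a | a ∈ S ∧ f a = k}.ncard := by
  classical
  rw [Set.ncard_eq_toFinset_card S hS,
    Finset.card_eq_sum_card_fiberwise (f := f) (t := Finset.range N)]
  · refine Finset.sum_congr rfl fun k _ => ?_
    rw [← Set.ncard_coe_finset]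
    congr 1
    ext a
    simp
  · intro a ha
    simpa using hf a (by simpa using ha)

theorem multisetGF_congr {Q R : Multiset ℕ → Prop} {m : ℕ}
    (h : ∀ s : Multiset ℕ, s.card = m → (Q s ↔ R s)) : multisetGF Q m = multisetGF R m := by
  ext n
  simp only [multisetGF, PowerSeries.coeff_mk]
  congr 3
  ext s
  exact and_congr_right fun hs => h s hs.1

theorem multisetGF_zero {Q : Multiset ℕ → Prop} (hQ : Q 0) : multisetGF Q 0 = 1 := by
  ext n
  simp only [multisetGF, PowerSeries.coeff_mk, PowerSeries.coeff_one, Multiset.card_eq_zero]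
  split_ifs with hn
  · rw [show {s : Multiset ℕ | (s = 0 ∧ s.sum = n) ∧ Q s} = {0} by
      ext s
      simp only [Set.mem_ofPred_eq, Set.mem_singleton_iff]
      exact ⟨fun h => h.1.1, by rintro rfl; simp [hn, hQ]⟩]
    simp
  · rw [show {s : Multiset ℕ | (s = 0 ∧ s.sum = n) ∧ Q s} = ∅ by
      ext s
      simp only [Set.mem_ofPred_eq, Set.mem_empty_iff_false, iff_false]
      rintro ⟨⟨rfl, h⟩, -⟩
      exact hn (by simpa using h.symm)]
    simp

theorem multisetGF_split (Q U : Multiset ℕ → Prop) (m : ℕ) :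
    multisetGF Q m = multisetGF (fun s => Q s ∧ U s) m + multisetGF (fun s => Q s ∧ ¬ U s) m := by
  ext n
  simp only [multisetGF, PowerSeries.coeff_mk, map_add]
  rw [← Set.ncard_inter_add_ncard_sdiff_eq_ncard _ {s | U s} (finite_multiset_card_sum m n Q),
    Nat.cast_add]
  refine congrArg₂ (· + ·) ?_ ?_ <;> congr 2 <;> ext s <;>
    simp [and_assoc]

theorem multisetGF_eq_sum_antidiagonal (Q : Multiset ℕ → Prop) (f : Multiset ℕ → ℕ)
    (hf : ∀ s, f s ≤ s.card) (m : ℕ) :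
    multisetGF Q m =
      ∑ x ∈ Finset.HasAntidiagonal.antidiagonal m,
        multisetGF (fun s => Q s ∧ f s = x.1) (x.1 + x.2) := by
  rw [Finset.Nat.sum_antidiagonal_eq_sum_range_succ_mk]
  ext n
  rw [map_sum]
  simp only [multisetGF, PowerSeries.coeff_mk]
  rw [(finite_multiset_card_sum m n Q).ncard_eq_sum_ncard_fiber f (N := m + 1)
    fun s hs => Nat.lt_succ_of_le (hs.1.1 ▸ hf s), Nat.cast_sum]
  refine Finset.sum_congr rfl fun k hk => ?_
  rw [Nat.add_sub_cancel' (Nat.lt_succ_iff.1 (Finset.mem_range.1 hk))]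
  simp only [Set.mem_ofPred_eq, and_assoc]

/-- Transport of generating functions along a map adjoining `j` copies of `c` to the image of
a multiset under an injection. -/
theorem multisetGF_shift {Q R : Multiset ℕ → Prop} {m j k c : ℕ} {g : ℕ → ℕ}
    (hg : Function.Injective g)
    (hQR : ∀ t, Q t → R (Multiset.replicate j c + t.map g))
    (hRQ : ∀ s, R s → ∃ t, Q t ∧ Multiset.replicate j c + t.map g = s)
    (hsum : ∀ t : Multiset ℕ, t.card = m → Q t → (t.map g).sum + j * c = t.sum + k) :
    multisetGF R (m + j) = PowerSeries.X ^ k * multisetGF Q m := by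
  have hsum' (t : Multiset ℕ) (h : t.card = m) (hQ : Q t) :
      (Multiset.replicate j c + t.map g).sum = t.sum + k := by
    rw [Multiset.sum_add, Multiset.sum_replicate, smul_eq_mul, add_comm, hsum t h hQ]
  have hcard (t : Multiset ℕ) : (Multiset.replicate j c + t.map g).card = t.card + j := by
    simp [add_comm]
  ext n
  rw [PowerSeries.coeff_X_pow_mul']
  simp only [multisetGF, PowerSeries.coeff_mk]
  split_ifs with hn
  · rw [← Set.ncard_image_of_injective {s : Multiset ℕ | (s.card = m ∧ s.sum = n - k) ∧ Q s}
      ((add_right_injective (Multiset.replicate j c)).comp (Multiset.map_injective hg))]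
    congr 2
    ext s
    simp only [Set.mem_ofPred_eq, Set.mem_image, Function.comp_apply]
    constructor
    · rintro ⟨⟨h1, h2⟩, hR⟩
      obtain ⟨t, hQ, rfl⟩ := hRQ s hR
      rw [hcard] at h1
      rw [hsum' t (by omega) hQ] at h2
      exact ⟨t, ⟨⟨by omega, by omega⟩, hQ⟩, rfl⟩
    · rintro ⟨t, ⟨⟨h1, h2⟩, hQ⟩, rfl⟩
      rw [hcard, hsum' t h1 hQ]
      exact ⟨⟨by omega, by omega⟩, hQR t hQ⟩
  · rw [show {s : Multiset ℕ | (s.card = m + j ∧ s.sum = n) ∧ R s} = ∅ by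
      ext s
      simp only [Set.mem_ofPred_eq, Set.mem_empty_iff_false, iff_false]
      rintro ⟨⟨h1, h2⟩, hR⟩
      obtain ⟨t, hQ, rfl⟩ := hRQ s hR
      rw [hcard] at h1
      rw [hsum' t (by omega) hQ] at h2
      omega]
    simp

/-- All elements are `1` modulo `c`, and no window `{x, x + c}` contains more than `d` elements. -/
def Multiset.Spaced (c d : ℕ) (s : Multiset ℕ) : Prop :=
  (∀ x ∈ s, ∃ y, x = 1 + c * y) ∧ ∀ x, s.count x + s.count (x + c) ≤ d

theorem multisetGF_spaced_shift {c d j : ℕ} (hc : 0 < c) (hj : j ≤ d) (m : ℕ) :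
    multisetGF (fun s => s.Spaced c d ∧ s.count 1 = j) (m + j) =
      PowerSeries.X ^ (c * m + j) * multisetGF (fun s => s.Spaced c d ∧ s.count 1 ≤ d - j) m := by
  have hinj : Function.Injective (· + c) := add_left_injective c
  have hmap (t : Multiset ℕ) (x : ℕ) : (t.map (· + c)).count (x + c) = t.count x :=
    Multiset.count_map_eq_count' _ _ hinj x
  have hlt (t : Multiset ℕ) (x : ℕ) (hx : x < c) : (t.map (· + c)).count x = 0 := by
    refine Multiset.count_eq_zero.2 fun h => ?_
    obtain ⟨y, -, rfl⟩ := Multiset.mem_map.1 h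
    omega
  refine multisetGF_shift hinj (c := 1) ?_ ?_ ?_
  · rintro t ⟨⟨hmod, ht⟩, h1⟩
    have h0 : t.count 0 = 0 := by
      refine Multiset.count_eq_zero.2 fun h => ?_
      obtain ⟨y, hy⟩ := hmod 0 h
      omega
    refine ⟨⟨fun x hx => ?_, fun x => ?_⟩, ?_⟩
    · rcases Multiset.mem_add.1 hx with hx | hx
      · exact ⟨0, by rw [Multiset.eq_of_mem_replicate hx]; simp⟩
      · obtain ⟨y, hy, rfl⟩ := Multiset.mem_map.1 hx
        obtain ⟨z, rfl⟩ := hmod y hy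
        exact ⟨z + 1, by ring⟩
    · simp only [Multiset.count_add, Multiset.count_replicate, hmap]
      rcases lt_or_ge x c with hx | hx
      · rw [hlt t x hx]
        have := ht x
        by_cases hx1 : x = 1
        · subst hx1
          split_ifs <;> omega
        · by_cases hx0 : x = 0
          · subst hx0
            rw [if_neg one_ne_zero]
            split_ifs <;> omega
          · split_ifs <;> omega
      · obtain ⟨y, rfl⟩ := Nat.exists_eq_add_of_le' hx
        rw [hmap]
        have := ht y
        by_cases hy : y = 0
        · subst hy
          by_cases hc1 : c = 1
          · subst hc1
            rw [h0, if_pos (zero_add 1).symm, if_neg (by omega)]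
            simp only [zero_add]
            omega
          · split_ifs <;> omega
        · split_ifs <;> omega
    · rw [Multiset.count_add, Multiset.count_replicate_self]
      rcases eq_or_ne c 1 with rfl | hc1
      · have := hmap t 0
        simp only [zero_add] at this
        omega
      · rw [hlt t 1 (by omega), add_zero]
  · rintro s ⟨⟨hmod, hs⟩, h1⟩
    have hmap' : ((s.filter (¬ · = 1)).map (· - c)).map (· + c) = s.filter (¬ · = 1) := by
      rw [Multiset.map_map]
      conv_rhs => rw [← Multiset.map_id (s.filter (¬ · = 1))]
      refine Multiset.map_congr rfl fun x hx => ?_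
      obtain ⟨hx, hx1⟩ := Multiset.mem_filter.1 hx
      obtain ⟨_ | y, rfl⟩ := hmod x hx
      · simp at hx1
      · simp only [Function.comp_apply, id, mul_add]
        omega
    set t := (s.filter (¬ · = 1)).map (· - c) with ht
    have hts : Multiset.replicate j 1 + t.map (· + c) = s := by
      rw [hmap', ← h1, ← Multiset.filter_eq', Multiset.filter_add_not]
    have hcount (x : ℕ) : t.count x ≤ s.count (x + c) := by
      rw [← hts, Multiset.count_add, hmap]
      omega
    refine ⟨t, ⟨⟨fun x hx => ?_, fun x => ?_⟩, ?_⟩, hts⟩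
    · obtain ⟨y, hy, rfl⟩ := Multiset.mem_map.1 hx
      obtain ⟨hy, hy1⟩ := Multiset.mem_filter.1 hy
      obtain ⟨_ | z, rfl⟩ := hmod y hy
      · simp at hy1
      · exact ⟨z, by rw [mul_add]; omega⟩
    · exact (Nat.add_le_add (hcount x) (hcount (x + c))).trans (hs _)
    · have h2 := hs 1
      have h3 := hcount 1
      omega
  · rintro t rfl -
    rw [Multiset.sum_map_add]
    simp
    ring

theorem multisetGF_spaced_succ {c d : ℕ} (j m : ℕ) :
    multisetGF (fun s => s.Spaced c d ∧ s.count 1 ≤ j + 1) m =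
      multisetGF (fun s => s.Spaced c d ∧ s.count 1 ≤ j) m +
      multisetGF (fun s => s.Spaced c d ∧ s.count 1 = j + 1) m := by
  rw [multisetGF_split _ fun s => s.count 1 ≤ j]
  congr 1 <;> refine multisetGF_congr fun s _ => ?_ <;> constructor <;> rintro ⟨h, h'⟩ <;>
    simp_all <;> omega

theorem Multiset.spaced_zero (c d : ℕ) : Multiset.Spaced c d 0 := by
  simp [Multiset.Spaced]

theorem multisetGF_spaced_eq_zero_of_card_lt {c d j m : ℕ} (h : m < j) :
    multisetGF (fun s => s.Spaced c d ∧ s.count 1 = j) m = 0 := by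
  ext n
  simp only [multisetGF, PowerSeries.coeff_mk, map_zero, Nat.cast_eq_zero]
  rw [Set.ncard_eq_zero (finite_multiset_card_sum m n _)]
  ext s
  simp only [Set.mem_ofPred_eq, Set.mem_empty_iff_false, iff_false]
  rintro ⟨⟨h1, -⟩, -, h2⟩
  have := Multiset.count_le_card 1 s
  omega

/-- The odd elements form a multiset satisfying `H`, and there are `k` even elements, all of
them at least `L`. -/
def Multiset.EvenOddClass (H : Multiset ℕ → Prop) (L k : ℕ) (s : Multiset ℕ) : Prop :=
  (H (s.filter (¬ Even ·)) ∧ ∀ x ∈ s, Even x → L ≤ x) ∧ (s.filter Even).card = k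

theorem multisetGF_evenOddClass_mem (H : Multiset ℕ → Prop) {L : ℕ} (hL : Even L) (k m : ℕ) :
    multisetGF (fun s => s.EvenOddClass H L (k + 1) ∧ L ∈ s) (m + 1) =
      PowerSeries.X ^ L * multisetGF (Multiset.EvenOddClass H L k) m := by
  refine multisetGF_shift (c := L) (g := id) Function.injective_id ?_ ?_ ?_
  · rintro t ⟨⟨hH, ht⟩, hk⟩
    rw [Multiset.map_id, Multiset.replicate_one, Multiset.singleton_add]
    refine ⟨⟨⟨?_, ?_⟩, ?_⟩, Multiset.mem_cons_self _ _⟩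
    · rwa [Multiset.filter_cons_of_neg _ (by simpa using hL)]
    · intro x hx hx2
      rcases Multiset.mem_cons.1 hx with rfl | hx
      · exact le_rfl
      · exact ht x hx hx2
    · rw [Multiset.filter_cons_of_pos _ hL, Multiset.card_cons, hk]
  · rintro s ⟨⟨⟨hH, hs⟩, hk⟩, hmem⟩
    obtain ⟨t, rfl⟩ := Multiset.exists_cons_of_mem hmem
    rw [Multiset.filter_cons_of_neg _ (by simpa using hL)] at hH
    rw [Multiset.filter_cons_of_pos _ hL, Multiset.card_cons] at hk
    exact ⟨t, ⟨⟨hH, fun x hx => hs x (Multiset.mem_cons_of_mem hx)⟩, by omega⟩, by simp⟩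
  · simp

theorem multisetGF_evenOddClass_not_mem (H : Multiset ℕ → Prop) {L : ℕ} (hL : Even L) (k m : ℕ) :
    multisetGF (fun s => s.EvenOddClass H L k ∧ L ∉ s) m =
      PowerSeries.X ^ (2 * k) * multisetGF (Multiset.EvenOddClass H L k) m := by
  set g : ℕ → ℕ := fun x => if Even x then x + 2 else x with hg
  have g_even (x : ℕ) : Even (g x) ↔ Even x := by
    simp only [hg]
    split_ifs with h <;> simp [h, Nat.even_add]
  have g_inj : Function.Injective g := by
    intro x y hxy
    have h : Even x ↔ Even y := by rw [← g_even, hxy, g_even]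
    simp only [hg, h] at hxy
    split_ifs at hxy <;> omega
  have filter_odd (t : Multiset ℕ) : (t.map g).filter (¬ Even ·) = t.filter (¬ Even ·) := by
    rw [Multiset.filter_map]
    conv_rhs => rw [← Multiset.map_id (t.filter (¬ Even ·))]
    refine Multiset.map_congr (Multiset.filter_congr fun x _ => not_congr (g_even x)) fun x hx => ?_
    rw [Multiset.mem_filter] at hx
    simp [hg, hx.2]
  have card_even (t : Multiset ℕ) : ((t.map g).filter Even).card = (t.filter Even).card := by
    rw [Multiset.filter_map, Multiset.card_map]
    congr 1
    exact Multiset.filter_congr fun x _ => by simp [g_even]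
  refine multisetGF_shift (j := 0) (c := 0) g_inj ?_ ?_ ?_
  · rintro t ⟨⟨hH, ht⟩, hk⟩
    rw [Multiset.replicate_zero, zero_add]
    refine ⟨⟨⟨by rwa [filter_odd], ?_⟩, by rwa [card_even]⟩, ?_⟩
    · intro x hx hx2
      obtain ⟨y, hy, rfl⟩ := Multiset.mem_map.1 hx
      have h2 := (g_even y).1 hx2
      have := ht y hy h2
      simp only [hg, h2, if_true]
      omega
    · intro hmem
      obtain ⟨y, hy, rfl⟩ := Multiset.mem_map.1 hmem
      have h2 := (g_even y).1 hL
      have := ht y hy h2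
      simp only [hg, h2, if_true] at this
      omega
  · rintro s ⟨⟨⟨hH, hs⟩, hk⟩, hmem⟩
    have hge (x : ℕ) (hx : x ∈ s) (h2 : Even x) : L + 2 ≤ x := by
      have h1 := hs x hx h2
      have h3 : x ≠ L := by rintro rfl; exact hmem hx
      obtain ⟨a, rfl⟩ := hL
      obtain ⟨b, rfl⟩ := h2
      omega
    have hmap : (s.map fun x => if Even x then x - 2 else x).map g = s := by
      rw [Multiset.map_map]
      conv_rhs => rw [← Multiset.map_id s]
      refine Multiset.map_congr rfl fun x hx => ?_
      by_cases h2 : Even x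
      · have h4 := hge x hx h2
        have h3 : Even (x - 2) := by
          obtain ⟨b, rfl⟩ := h2
          exact ⟨b - 1, by omega⟩
        simp only [Function.comp_apply, hg, h2, h3, if_true, id]
        omega
      · simp [hg, h2]
    generalize (s.map fun x => if Even x then x - 2 else x) = t at hmap
    subst hmap
    rw [filter_odd] at hH
    rw [card_even] at hk
    refine ⟨t, ⟨⟨hH, fun x hx h2 => ?_⟩, hk⟩, by simp⟩
    have := hge (g x) (Multiset.mem_map_of_mem g hx) ((g_even x).2 h2)
    simp only [hg, h2, if_true] at this
    omega
  · rintro t - ⟨-, rfl⟩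
    rw [zero_mul, add_zero]
    induction t using Multiset.induction_on with
    | empty => simp
    | cons a t ih =>
      rw [Multiset.map_cons, Multiset.sum_cons, ih, Multiset.sum_cons]
      by_cases h2 : Even a
      · rw [Multiset.filter_cons_of_pos _ h2, Multiset.card_cons]
        simp only [hg, h2, if_true]
        ring
      · rw [Multiset.filter_cons_of_neg _ h2]
        simp only [hg, h2, if_false]
        ring

/-- The generating function of partitions into at most `n` parts, all even. -/
noncomputable def evenPartitionGF (n : ℕ) : PowerSeries ℚ :=
  ∏ k ∈ Finset.range n, (1 - PowerSeries.X ^ (2 * (k + 1)))⁻¹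

theorem evenPartitionGF_succ (n : ℕ) :
    evenPartitionGF (n + 1) =
      evenPartitionGF n + PowerSeries.X ^ (2 * (n + 1)) * evenPartitionGF (n + 1) := by
  have h := PowerSeries.mul_inv_cancel (1 - PowerSeries.X ^ (2 * (n + 1)) : PowerSeries ℚ)
    (by simp)
  rw [evenPartitionGF, Finset.prod_range_succ, ← evenPartitionGF]
  linear_combination evenPartitionGF n * h

theorem PowerSeries.X_pow_succ_ne_one (n : ℕ) :
    (PowerSeries.X : PowerSeries ℚ) ^ (n + 1) ≠ 1 := by
  intro h
  simpa using congrArg PowerSeries.constantCoeff h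

theorem multisetGF_evenOddClass (H : Multiset ℕ → Prop) {L : ℕ} (hL : Even L) (k r : ℕ) :
    multisetGF (Multiset.EvenOddClass H L k) (k + r) =
      PowerSeries.X ^ (L * k) * evenPartitionGF k *
        multisetGF (fun s => H s ∧ ∀ x ∈ s, ¬ Even x) r := by
  induction k with
  | zero =>
    rw [zero_add, mul_zero, pow_zero, one_mul, evenPartitionGF, Finset.prod_range_zero, one_mul]
    refine multisetGF_congr fun s _ => ?_
    rw [Multiset.EvenOddClass, Multiset.card_eq_zero, Multiset.filter_eq_nil]
    constructor
    · rintro ⟨⟨h1, -⟩, h2⟩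
      rw [Multiset.filter_eq_self.2 h2] at h1
      exact ⟨h1, h2⟩
    · rintro ⟨h1, h2⟩
      rw [Multiset.filter_eq_self.2 h2]
      exact ⟨⟨h1, fun x hx h => absurd h (h2 x hx)⟩, h2⟩
  | succ k ih =>
    have h := multisetGF_split (Multiset.EvenOddClass H L (k + 1)) (L ∈ ·) (k + r + 1)
    rw [multisetGF_evenOddClass_mem H hL, multisetGF_evenOddClass_not_mem H hL, ih] at h
    rw [add_right_comm]
    apply mul_left_cancel₀ (sub_ne_zero.2 (PowerSeries.X_pow_succ_ne_one (2 * k + 1)).symm)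
    linear_combination h - PowerSeries.X ^ (L * (k + 1)) *
      multisetGF (fun s => H s ∧ ∀ x ∈ s, ¬ Even x) r * evenPartitionGF_succ k

theorem card_partition_eq_sum_coeff (n : ℕ) (Q : Multiset ℕ → Prop) :
    (Nat.card {p : n.Partition // Q p.parts} : ℚ) =
      ∑ m ∈ Finset.range (n + 1),
        PowerSeries.coeff n (multisetGF (fun s => Q s ∧ ∀ x ∈ s, 0 < x) m) := by
  have hinj : Function.Injective (Nat.Partition.parts : n.Partition → Multiset ℕ) :=
    fun p q h => Nat.Partition.ext h
  have himage : (Nat.Partition.parts : n.Partition → Multiset ℕ) '' {p | Q p.parts} =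
      {s : Multiset ℕ | s.sum = n ∧ Q s ∧ ∀ x ∈ s, 0 < x} := by
    ext s
    constructor
    · rintro ⟨p, hp, rfl⟩
      exact ⟨p.parts_sum, hp, fun x hx => p.parts_pos hx⟩
    · rintro ⟨h1, h2, h3⟩
      exact ⟨⟨s, fun {i} hi => h3 i hi, h1⟩, h2, rfl⟩
  have hcard : Nat.card {p : n.Partition // Q p.parts} =
      {s : Multiset ℕ | s.sum = n ∧ Q s ∧ ∀ x ∈ s, 0 < x}.ncard := by
    rw [← himage, Set.ncard_image_of_injective _ hinj]
    rfl
  rw [hcard, Set.Finite.ncard_eq_sum_ncard_fiber (himage ▸ (Set.toFinite _).image _) Multiset.card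
    (N := n + 1), Nat.cast_sum]
  · refine Finset.sum_congr rfl fun m _ => ?_
    rw [multisetGF, PowerSeries.coeff_mk]
    congr 2
    ext s
    simp only [Set.mem_ofPred_eq]
    tauto
  · rintro s ⟨h1, -, h3⟩
    have := Multiset.card_nsmul_le_sum (s := s) (a := 1) h3
    rw [smul_eq_mul, mul_one] at this
    omega

theorem gapCond_sort_iff_count_add_count_le {c d : ℕ} (hc : 0 < c) {s : Multiset ℕ}
    (hmod : ∀ x ∈ s, ∃ y, x = 1 + c * y) :
    GapCond (s.sort (· ≤ ·)) (d + 1) (2 * c) ↔ s.Spaced c (d + 1) := by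
  rw [gapCond_iff_count_add_count_le hc (Multiset.pairwise_sort s _) (by simpa using hmod),
    Multiset.Spaced, and_iff_right hmod]
  simp only [← Multiset.coe_count, Multiset.sort_eq]

theorem sum_evenOddClass_eq_spaced (m j : ℕ) (hj : j ≤ 1) :
    ∑ x ∈ Finset.HasAntidiagonal.antidiagonal m,
      multisetGF (Multiset.EvenOddClass (fun s => s.Spaced 2 2 ∧ s.count 1 ≤ j) (2 * m) x.1)
        (x.1 + x.2) =
      multisetGF (fun s => s.Spaced 1 1 ∧ s.count 1 ≤ j) m := by
  have hodd (j r : ℕ) : multisetGF (fun s => (s.Spaced 2 2 ∧ s.count 1 ≤ j) ∧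
      ∀ x ∈ s, ¬ Even x) r = multisetGF (fun s => s.Spaced 2 2 ∧ s.count 1 ≤ j) r := by
    refine multisetGF_congr fun s _ => and_iff_left_of_imp ?_
    rintro ⟨⟨h, -⟩, -⟩ x hx h2
    obtain ⟨y, rfl⟩ := h x hx
    obtain ⟨z, hz⟩ := h2
    omega
  simp only [multisetGF_evenOddClass _ (even_two_mul m), hodd]
  have hzero (c d j : ℕ) : multisetGF (fun s => s.Spaced c d ∧ s.count 1 ≤ j) 0 = 1 :=
    multisetGF_zero ⟨Multiset.spaced_zero c d, by simp⟩
  have hcongr (c d m : ℕ) : multisetGF (fun s => s.Spaced c d ∧ s.count 1 = 0) m =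
      multisetGF (fun s => s.Spaced c d ∧ s.count 1 ≤ 0) m := by
    simp only [Nat.le_zero]
  have key := sum_eq_of_rogersRamanujan_recurrences PowerSeries.X PowerSeries.X_pow_succ_ne_one
    evenPartitionGF
    (multisetGF fun s => s.Spaced 2 2 ∧ s.count 1 ≤ 0)
    (multisetGF fun s => s.Spaced 2 2 ∧ s.count 1 ≤ 1)
    (multisetGF fun s => s.Spaced 2 2 ∧ s.count 1 ≤ 2)
    (multisetGF fun s => s.Spaced 1 1 ∧ s.count 1 ≤ 0)
    (multisetGF fun s => s.Spaced 1 1 ∧ s.count 1 ≤ 1)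
    (by simp [evenPartitionGF]) evenPartitionGF_succ
    (fun r => by
      rw [← hcongr]
      exact multisetGF_spaced_shift two_pos (Nat.zero_le _) r)
    (hzero _ _ _)
    (fun r => by
      rw [multisetGF_spaced_succ]
      exact congrArg _ (multisetGF_spaced_shift two_pos one_le_two r))
    (hzero _ _ _)
    (by
      rw [multisetGF_spaced_succ, multisetGF_spaced_eq_zero_of_card_lt (by omega), add_zero])
    (fun r => by
      rw [multisetGF_spaced_succ]
      exact congrArg _ (multisetGF_spaced_shift two_pos le_rfl r))
    (fun m => by
      rw [← hcongr]
      have := multisetGF_spaced_shift one_pos (Nat.zero_le 1) m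
      rwa [one_mul] at this)
    (hzero _ _ _)
    (fun m => by
      rw [multisetGF_spaced_succ]
      have := multisetGF_spaced_shift one_pos (le_refl 1) m
      rw [one_mul] at this
      exact congrArg _ this) m
  obtain rfl | rfl : j = 0 ∨ j = 1 := by omega
  · exact key.1
  · exact key.2

/-- **Even-odd member of the Rogers-Ramanujan identities.**
For every `n ≥ 0` and `i = 1` or `2`, the number of partitions of `n` with at
most `i - 1` parts equal to `1`, every even part at least twice the number of
parts, and odd parts (in decreasing order) satisfying
`λ_{j_ℓ} - λ_{j_{ℓ+2}} ≥ 4`, equals the number of partitions of `n` with any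
two parts differing by at least `2` and at most `i - 1` parts equal to `1`. -/
theorem evenOdd_rogersRamanujan_P_eq_B (n i : ℕ) (hi : i = 1 ∨ i = 2) :
    Nat.card {p : n.Partition //
      Multiset.count 1 p.parts ≤ i - 1 ∧
      (∀ x ∈ p.parts, Even x → 2 * Multiset.card p.parts ≤ x) ∧
      GapCond p.oddParts 2 4} =
    Nat.card {p : n.Partition //
      GapCond p.sortedParts 1 2 ∧
      Multiset.count 1 p.parts ≤ i - 1} := by
  have hi' : i - 1 ≤ 1 := by omega
  set j := i - 1
  have hP := card_partition_eq_sum_coeff n fun s => s.count 1 ≤ j ∧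
    (∀ x ∈ s, Even x → 2 * s.card ≤ x) ∧ GapCond ((s.filter fun x => ¬ Even x).sort (· ≤ ·)) 2 4
  have hB := card_partition_eq_sum_coeff n fun s =>
    GapCond (s.sort (· ≤ ·)) 1 2 ∧ s.count 1 ≤ j
  refine Nat.cast_injective (R := ℚ) (hP.trans (Eq.trans ?_ hB.symm))
  refine Finset.sum_congr rfl fun m _ => congrArg _ ?_
  have hB' : multisetGF (fun s => (GapCond (s.sort (· ≤ ·)) 1 2 ∧ s.count 1 ≤ j) ∧
      ∀ x ∈ s, 0 < x) m = multisetGF (fun s => s.Spaced 1 1 ∧ s.count 1 ≤ j) m := by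
    refine multisetGF_congr fun s _ => ⟨?_, ?_⟩
    · rintro ⟨⟨h1, h2⟩, h3⟩
      refine ⟨(gapCond_sort_iff_count_add_count_le one_pos fun x hx => ?_).1 h1, h2⟩
      exact ⟨x - 1, by have := h3 x hx; omega⟩
    · rintro ⟨h1, h2⟩
      refine ⟨⟨(gapCond_sort_iff_count_add_count_le one_pos h1.1).2 h1, h2⟩, fun x hx => ?_⟩
      obtain ⟨y, rfl⟩ := h1.1 x hx
      omega
  rw [hB', ← sum_evenOddClass_eq_spaced m j hi']
  have hsum := multisetGF_eq_sum_antidiagonal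
    (fun s => ((s.filter (¬ Even ·)).Spaced 2 2 ∧ (s.filter (¬ Even ·)).count 1 ≤ j) ∧
      ∀ x ∈ s, Even x → 2 * m ≤ x)
    (fun s => (s.filter Even).card) (fun s => Multiset.card_le_card (Multiset.filter_le _ s)) m
  refine Eq.trans ?_ hsum
  refine multisetGF_congr fun s hs => ?_
  have hmod : ∀ x ∈ s.filter (¬ Even ·), ∃ y, x = 1 + 2 * y := by
    intro x hx
    obtain ⟨y, rfl⟩ := Nat.not_even_iff_odd.1 (Multiset.mem_filter.1 hx).2
    exact ⟨y, by ring⟩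
  have hcount : (s.filter (¬ Even ·)).count 1 = s.count 1 :=
    Multiset.count_filter_of_pos (by decide)
  rw [hcount, ← gapCond_sort_iff_count_add_count_le (c := 2) (d := 1) two_pos hmod, hs]
  constructor
  · rintro ⟨⟨h1, h2, h3⟩, -⟩
    exact ⟨⟨h3, h1⟩, h2⟩
  · rintro ⟨⟨h3, h1⟩, h2⟩
    refine ⟨⟨h1, h2, h3⟩, fun x hx => Nat.pos_of_ne_zero ?_⟩
    rintro rfl
    have := h2 0 hx (by simp)
    have := Multiset.card_pos_iff_exists_mem.2 ⟨0, hx⟩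
    omega
end

section
/- For every nonnegative integer n and for i = 1 or i = 2, the number P_{2,i}(n) of partitions of n with at most i-1 parts equal to 1, in which every even part is at least 2m (where m is the total number of parts of the partition), and in which the odd parts, listed in decreasing order, satisfy λ_{j_ℓ} - λ_{j_{ℓ+2}} ≥ 4 for every valid index ℓ, equals the number A_{2,i}(n) of partitions of n all of whose parts are not congruent to 0, i, or -i modulo 5. -/
namespace RogersRamanujan

open Finset

/-- `e k` is the inverse of the `q`-factorial `(1 - q) (1 - q ^ 2) ⋯ (1 - q ^ k)`, none of whose
factors vanishes. -/
structure IsInvQFactorial {R : Type*} [CommRing R] (q : R) (e : ℕ → R) : Prop where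
  zero : e 0 = 1
  succ : ∀ k, (1 - q ^ (k + 1)) * e (k + 1) = e k
  ne : ∀ k, 1 - q ^ (k + 1) ≠ 0

theorem choose_two_add (m n : ℕ) : (m + n).choose 2 = m.choose 2 + n.choose 2 + m * n := by
  induction n with
  | zero => simp
  | succ n ih =>
    rw [← add_assoc, Nat.choose_succ_succ' (m + n) 1, ih, Nat.choose_succ_succ' n 1]
    simp only [Nat.choose_one_right]
    ring

theorem sum_antidiagonal_assoc {M : Type*} [AddCommMonoid M] (f : ℕ → ℕ → ℕ → M) (n : ℕ) :
    ∑ p ∈ antidiagonal n, ∑ r ∈ antidiagonal p.1, f r.1 r.2 p.2 =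
      ∑ p ∈ antidiagonal n, ∑ r ∈ antidiagonal p.2, f p.1 r.1 r.2 := by
  rw [sum_sigma', sum_sigma']
  refine sum_nbij' (fun x => ⟨(x.2.1, x.2.2 + x.1.2), (x.2.2, x.1.2)⟩)
    (fun x => ⟨(x.1.1 + x.2.1, x.2.2), (x.1.1, x.2.1)⟩) ?_ ?_ ?_ ?_ ?_
  all_goals
    rintro ⟨⟨a, b⟩, ⟨c, d⟩⟩ h
    simp only [mem_sigma, HasAntidiagonal.mem_antidiagonal] at h
    obtain ⟨h₁, h₂⟩ := h
    subst h₂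
    simp_all [add_assoc]

namespace IsInvQFactorial

section Algebra

variable {R : Type*} [CommRing R] {q : R} {e : ℕ → R} (h : IsInvQFactorial q e)
include h

theorem sum_antidiagonal_mul_fst (g : ℕ → ℕ → R) (n : ℕ) :
    ∑ p ∈ antidiagonal (n + 1), (1 - q ^ p.1) * e p.1 * g p.1 p.2 =
      ∑ p ∈ antidiagonal n, e p.1 * g (p.1 + 1) p.2 := by
  rw [Nat.sum_antidiagonal_succ]
  simp [h.succ]

theorem sum_antidiagonal_mul_snd (g : ℕ → ℕ → R) (n : ℕ) :
    ∑ p ∈ antidiagonal (n + 1), (1 - q ^ p.2) * e p.2 * g p.1 p.2 =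
      ∑ p ∈ antidiagonal n, e p.2 * g p.1 (p.2 + 1) := by
  rw [Nat.sum_antidiagonal_succ']
  simp [h.succ]

theorem mul_prod_one_sub (n : ℕ) : e n * ∏ i ∈ range n, (1 - q ^ (i + 1)) = 1 := by
  induction n with
  | zero => simp [h.zero]
  | succ n ih =>
    rw [prod_range_succ]
    linear_combination ih + (∏ i ∈ range n, (1 - q ^ (i + 1))) * h.succ n

variable [IsDomain R]

/-- A form of the `q`-Chu–Vandermonde identity. -/
theorem vandermonde (n d : ℕ) :
    ∑ p ∈ antidiagonal n, q ^ (p.1 * (p.1 + d)) * e p.1 * e (p.1 + d) * e p.2 =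
      e n * e (n + d) := by
  induction n generalizing d with
  | zero => simp [h.zero]
  | succ n ih =>
    apply mul_left_cancel₀ (h.ne n)
    have h₁ := h.sum_antidiagonal_mul_snd (fun u _ => q ^ (u * (u + d)) * e u * e (u + d)) n
    have h₂ := h.sum_antidiagonal_mul_fst
      (fun u v => q ^ (v + u * (u + d)) * e (u + d) * e v) n
    calc _ = ∑ p ∈ antidiagonal n, e p.2 * (q ^ (p.1 * (p.1 + d)) * e p.1 * e (p.1 + d)) +
          ∑ p ∈ antidiagonal n,
            e p.1 * (q ^ (p.2 + (p.1 + 1) * (p.1 + 1 + d)) * e (p.1 + 1 + d) * e p.2) := by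
          rw [← h₁, ← h₂, mul_sum, ← sum_add_distrib]
          refine sum_congr rfl fun p hp => ?_
          rw [← HasAntidiagonal.mem_antidiagonal.mp hp]
          ring
      _ = e n * e (n + d) + q ^ (n + 1 + d) * (e n * e (n + (d + 1))) := by
          rw [← ih d, ← ih (d + 1), mul_sum]
          congr 1
          · exact sum_congr rfl fun p _ => by ring
          · refine sum_congr rfl fun p hp => ?_
            rw [← HasAntidiagonal.mem_antidiagonal.mp hp, add_right_comm p.1 1 d, add_assoc p.1 d 1]
            ring
      _ = _ := by
          have h₃ := h.succ (n + d)
          rw [show n + 1 + d = n + d + 1 by ring, ← mul_assoc (1 - _), h.succ, ← add_assoc n d 1,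
            ← h₃]
          ring

/-- The `q`-binomial theorem. -/
theorem binomial (n : ℕ) (a b : R) :
    ∑ p ∈ antidiagonal n, q ^ p.1.choose 2 * b ^ p.1 * a ^ p.2 * e p.1 * e p.2 =
      e n * ∏ i ∈ range n, (a + b * q ^ i) := by
  induction n generalizing b with
  | zero => simp [h.zero]
  | succ n ih =>
    apply mul_left_cancel₀ (h.ne n)
    have h₁ := h.sum_antidiagonal_mul_fst (fun u v => q ^ u.choose 2 * b ^ u * a ^ v * e v) n
    have h₂ := h.sum_antidiagonal_mul_snd
      (fun u v => q ^ u * q ^ u.choose 2 * b ^ u * a ^ v * e u) n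
    calc _ = ∑ p ∈ antidiagonal n,
            e p.1 * (q ^ (p.1 + 1).choose 2 * b ^ (p.1 + 1) * a ^ p.2 * e p.2) +
          ∑ p ∈ antidiagonal n,
            e p.2 * (q ^ p.1 * q ^ p.1.choose 2 * b ^ p.1 * a ^ (p.2 + 1) * e p.1) := by
          rw [← h₁, ← h₂, mul_sum, ← sum_add_distrib]
          refine sum_congr rfl fun p hp => ?_
          rw [← HasAntidiagonal.mem_antidiagonal.mp hp]
          ring
      _ = (a + b) * (e n * ∏ i ∈ range n, (a + b * q * q ^ i)) := by
          rw [← ih (b * q), mul_sum, ← sum_add_distrib]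
          refine sum_congr rfl fun p hp => ?_
          rw [Nat.choose_succ_succ' p.1 1, Nat.choose_one_right]
          ring
      _ = _ := by
          rw [← mul_assoc (1 - _), h.succ, prod_range_succ', pow_zero, mul_one]
          simp only [pow_succ' q, ← mul_assoc]
          ring

/-- A finite form of the Jacobi triple product identity. -/
theorem triple_product {x y : R} (hx : x ≠ 0) (hq : q ≠ 0) (hxy : x * y = q) (n : ℕ) :
    e n * e n + ∑ j ∈ range n, (-1) ^ (j + 1) * q ^ (j + 1).choose 2 *
        (x ^ (j + 1) + y ^ (j + 1)) * e (n - (j + 1)) * e (n + (j + 1)) =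
      e (2 * n) * ∏ i ∈ range n, ((1 - x * q ^ i) * (1 - y * q ^ i)) := by
  have hD : (-x) ^ n * q ^ (n * n + n.choose 2) ≠ 0 := by simp [hx, hq]
  apply mul_left_cancel₀ hD
  have hb := h.binomial (n + n) (q ^ n) (-x)
  have hprod : ∏ i ∈ range (n + n), (q ^ n + -x * q ^ i) = (-x) ^ n * q ^ (n * n + n.choose 2) *
      ∏ i ∈ range n, ((1 - x * q ^ i) * (1 - y * q ^ i)) := by
    have h₁ : ∏ i ∈ range n, (q ^ n + -x * q ^ i) =
        (-x) ^ n * q ^ n.choose 2 * ∏ i ∈ range n, (1 - y * q ^ i) := by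
      rw [Nat.choose_two_right, ← sum_range_id, ← prod_pow_eq_pow_sum,
        ← prod_range_reflect (fun i => q ^ i), ← prod_range_reflect (fun i => q ^ n + -x * q ^ i)]
      conv_rhs => enter [1, 1]; rw [← card_range n]
      rw [← prod_const, ← prod_mul_distrib, ← prod_mul_distrib]
      refine prod_congr rfl fun i hi => ?_
      obtain ⟨k, rfl⟩ := Nat.exists_eq_add_of_lt (mem_range.mp hi)
      rw [show i + k + 1 - 1 - i = k by omega, pow_add, pow_add]
      linear_combination (-q ^ i * q ^ k) * hxy
    have h₂ : ∏ i ∈ range n, (q ^ n + -x * q ^ (n + i)) =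
        q ^ (n * n) * ∏ i ∈ range n, (1 - x * q ^ i) := by
      rw [pow_mul]
      conv_rhs => enter [1, 2]; rw [← card_range n]
      rw [← prod_const, ← prod_mul_distrib]
      exact prod_congr rfl fun i _ => by ring
    rw [prod_range_add, h₁, h₂, prod_mul_distrib]
    ring
  have hsum : ∑ p ∈ antidiagonal (n + n), q ^ p.1.choose 2 * (-x) ^ p.1 * (q ^ n) ^ p.2 *
      e p.1 * e p.2 = (-x) ^ n * q ^ (n * n + n.choose 2) * (e n * e n +
      ∑ j ∈ range n, (-1) ^ (j + 1) * q ^ (j + 1).choose 2 *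
        (x ^ (j + 1) + y ^ (j + 1)) * e (n - (j + 1)) * e (n + (j + 1))) := by
    rw [Nat.sum_antidiagonal_eq_sum_range_succ
      (fun u v => q ^ u.choose 2 * (-x) ^ u * (q ^ n) ^ v * e u * e v), Nat.succ_eq_add_one,
      add_assoc, sum_range_add, sum_range_succ' _ n, ← sum_range_reflect]
    rw [mul_add, mul_sum, ← add_assoc, ← sum_add_distrib, add_comm]
    congr 1
    · simp only [add_zero, Nat.add_sub_cancel]
      ring
    · refine sum_congr rfl fun j hj => ?_
      obtain ⟨k, rfl⟩ := Nat.exists_eq_add_of_lt (mem_range.mp hj)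
      rw [show j + k + 1 - 1 - j = k by omega, show j + k + 1 - (j + 1) = k by omega,
        show j + k + 1 + (j + k + 1) - k = j + k + 1 + (j + 1) by omega,
        show j + k + 1 + (j + k + 1) - (j + k + 1 + (j + 1)) = k by omega]
      rw [show j + k + 1 = k + (j + 1) by ring]
      generalize j + 1 = m
      have hm : 2 * m.choose 2 + m = m * m := by
        rw [Nat.choose_two_right, Nat.mul_div_cancel' (Nat.even_mul_pred_self m).two_dvd]
        cases m <;> simp; ring
      have h₁ : q ^ k.choose 2 * (-x) ^ k * (q ^ (k + m)) ^ (k + m + m) = (-x) ^ (k + m) *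
          q ^ ((k + m) * (k + m) + (k + m).choose 2) * ((-1) ^ m * q ^ m.choose 2 * y ^ m) := by
        have hy : (-x) ^ m * ((-1) ^ m * y ^ m) = q ^ m := by
          rw [← mul_pow, ← mul_pow, ← hxy]
          ring
        calc _ = (-x) ^ k * q ^ (k.choose 2 + (k + m) * (k + m) + k * m + m * m) := by ring
          _ = (-x) ^ k * q ^ ((k + m) * (k + m) + (k + m).choose 2 + m.choose 2) *
              ((-x) ^ m * ((-1) ^ m * y ^ m)) := by
            rw [hy, choose_two_add, ← hm]
            ring
          _ = _ := by ring
      have h₂ : q ^ (k + m + m).choose 2 * (-x) ^ (k + m + m) * (q ^ (k + m)) ^ k =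
          (-x) ^ (k + m) * q ^ ((k + m) * (k + m) + (k + m).choose 2) *
            ((-1) ^ m * q ^ m.choose 2 * x ^ m) := by
        rw [choose_two_add (k + m) m, pow_add (-x) (k + m) m, neg_pow x m]
        ring
      rw [h₁, h₂]
      ring
  rw [← hsum, hb, hprod, ← two_mul]
  ring

/-- The sum over `j ≤ n` of `α j / ((q; q)_{n - j} (q; q)_{n + j + ε})`, where `e` stands for the
inverse `q`-factorials. -/
def _root_.RogersRamanujan.baileySum {R : Type*} [CommRing R] (e : ℕ → R) (ε : ℕ) (α : ℕ → R)
    (n : ℕ) : R :=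
  ∑ p ∈ antidiagonal n, α p.1 * e p.2 * e (p.2 + (2 * p.1 + ε))

/-- The coefficients of the theta series of the Jacobi triple product. -/
def _root_.RogersRamanujan.thetaCoeff {R : Type*} [CommRing R] (q x y : R) (j : ℕ) : R :=
  if j = 0 then 1 else (-1) ^ j * q ^ j.choose 2 * (x ^ j + y ^ j)

theorem baileySum_step (ε : ℕ) (α : ℕ → R) (n : ℕ) :
    ∑ p ∈ antidiagonal n, q ^ (p.1 * (p.1 + ε)) * e p.2 * baileySum e ε α p.1 =
      baileySum e ε (fun j => q ^ (j * (j + ε)) * α j) n := by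
  have h₁ := sum_antidiagonal_assoc (fun j u t =>
    q ^ ((j + u) * (j + u + ε)) * e t * (α j * e u * e (u + (2 * j + ε)))) n
  calc _ = _ := by
        refine (sum_congr rfl fun p _ => ?_).trans h₁
        rw [baileySum, mul_sum]
        refine sum_congr rfl fun r hr => ?_
        rw [← HasAntidiagonal.mem_antidiagonal.mp hr]
    _ = _ := by
        refine sum_congr rfl fun p _ => ?_
        rw [mul_assoc, ← h.vandermonde p.2 (2 * p.1 + ε), mul_sum]
        exact sum_congr rfl fun r _ => by ring

theorem baileySum_thetaCoeff {x y : R} (hx : x ≠ 0) (hq : q ≠ 0) (hxy : x * y = q) (n : ℕ) :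
    baileySum e 0 (thetaCoeff q x y) n =
      e (2 * n) * ∏ i ∈ range n, ((1 - x * q ^ i) * (1 - y * q ^ i)) := by
  rw [← h.triple_product hx hq hxy, baileySum, Nat.sum_antidiagonal_eq_sum_range_succ
    (fun j u => thetaCoeff q x y j * e u * e (u + (2 * j + 0))), Nat.succ_eq_add_one,
    sum_range_succ', add_comm]
  congr 1
  · simp [thetaCoeff]
  · refine sum_congr rfl fun j hj => ?_
    rw [mem_range] at hj
    rw [thetaCoeff, if_neg j.succ_ne_zero,
      show n - (j + 1) + (2 * (j + 1) + 0) = n + (j + 1) by omega]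

theorem baileySum_unit_zero (hq : q ≠ 0) (n : ℕ) :
    baileySum e 0 (thetaCoeff q 1 q) n = if n = 0 then 1 else 0 := by
  rw [h.baileySum_thetaCoeff one_ne_zero hq (one_mul q)]
  cases n with
  | zero => simp [h.zero]
  | succ n => simp [prod_range_succ']

theorem baileySum_unit_one (n : ℕ) :
    baileySum e 1 (fun j => (-1) ^ j * q ^ j.choose 2 * (1 - q ^ (2 * j + 1))) n =
      if n = 0 then 1 else 0 := by
  cases n with
  | zero => simpa [baileySum, h.zero] using h.succ 0
  | succ n =>
    have key (m : ℕ) (hm : m ≤ n + 1) : (1 - q ^ (n + 1)) * ∑ j ∈ range (m + 1),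
        (-1) ^ j * q ^ j.choose 2 * (1 - q ^ (2 * j + 1)) * e (n + 1 - j) *
          e (n + 1 - j + (2 * j + 1)) = (-1) ^ m * q ^ (m + 1).choose 2 * (1 - q ^ (m + 1)) *
          (1 - q ^ (n + 1 - m)) * e (n + 1 - m) * e (n + 1 + m + 1) := by
      induction m with
      | zero => simp; ring
      | succ m ih =>
        rw [sum_range_succ, mul_add, ih (by omega)]
        obtain ⟨k, rfl⟩ := Nat.exists_eq_add_of_le (Nat.le_of_succ_le_succ hm)
        rw [show m + k + 1 - m = k + 1 by omega, show m + k + 1 - (m + 1) = k by omega,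
          show k + (2 * (m + 1) + 1) = m + k + 1 + m + 1 + 1 by omega,
          show m + k + 1 + (m + 1) + 1 = m + k + 1 + m + 1 + 1 by omega,
          mul_assoc _ _ (e (k + 1)), h.succ, ← h.succ (m + k + 1 + m + 1),
          Nat.choose_succ_succ' (m + 1) 1, Nat.choose_one_right]
        ring
    rw [if_neg n.succ_ne_zero]
    apply mul_left_cancel₀ (h.ne n)
    rw [baileySum, Nat.sum_antidiagonal_eq_sum_range_succ (fun j u => (-1) ^ j * q ^ j.choose 2 *
      (1 - q ^ (2 * j + 1)) * e u * e (u + (2 * j + 1))), key (n + 1) le_rfl]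
    simp

theorem sum_eq_baileySum {ε : ℕ} {α : ℕ → R}
    (hα : ∀ n, baileySum e ε α n = if n = 0 then 1 else 0) (n : ℕ) :
    ∑ p ∈ antidiagonal n, q ^ (p.1 * (p.1 + ε)) * e p.2 * e p.1 =
      baileySum e ε (fun j => q ^ (j * (j + ε)) * (q ^ (j * (j + ε)) * α j)) n := by
  rw [← h.baileySum_step]
  refine sum_congr rfl fun p _ => ?_
  rw [← h.baileySum_step, sum_eq_single (0, p.1)]
  · simp [hα]
  · rintro ⟨a, b⟩ hab hne
    have : a ≠ 0 := by
      rintro rfl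
      simp_all
    simp [hα, this]
  · simp

end Algebra

section Truncation

variable {R A : Type*} [CommRing R] [CommRing A] {q : R} {e : ℕ → R} (h : IsInvQFactorial q e)
  (π : R →+* A) {n : ℕ}

theorem _root_.RogersRamanujan.map_pow_eq_zero {x : R} (hx : π (x ^ (n + 1)) = 0) {m : ℕ}
    (hm : n < m) : π (x ^ m) = 0 := by
  obtain ⟨k, rfl⟩ := Nat.exists_eq_add_of_lt hm
  rw [show n + k + 1 = n + 1 + k by ring, pow_add, map_mul, hx, zero_mul]

theorem _root_.RogersRamanujan.map_sum_antidiagonal {f : ℕ → R} {g : ℕ → ℕ → R} {c : A}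
    (hf : ∀ j, n < j → π (f j) = 0) (hg : ∀ j u, n ≤ u → π (g j u) = c) {N : ℕ} (hN : 2 * n ≤ N) :
    π (∑ p ∈ antidiagonal N, f p.1 * g p.1 p.2) = c * π (∑ j ∈ range (n + 1), f j) := by
  rw [Nat.sum_antidiagonal_eq_sum_range_succ (fun j u => f j * g j u), map_sum, map_sum, mul_sum]
  symm
  refine sum_subset_zero_on_sdiff (range_subset_range.mpr (by omega)) (fun j hj => ?_)
    fun j hj => ?_
  · rw [mem_sdiff, mem_range, mem_range] at hj
    rw [map_mul, hf j (by omega), zero_mul]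
  · rw [mem_range] at hj
    rw [map_mul, hg j (N - j) (by omega), mul_comm]

include h

theorem map_eq (hq : π (q ^ (n + 1)) = 0) {m : ℕ} (hm : n ≤ m) : π (e m) = π (e n) := by
  induction m, hm using Nat.le_induction with
  | base => rfl
  | succ m hm ih =>
    rw [← ih, ← h.succ m, map_mul, map_sub, map_pow_eq_zero π hq (by omega)]
    simp

theorem map_baileySum (hq : π (q ^ (n + 1)) = 0) {α : ℕ → R} (hα : ∀ j, n < j → π (α j) = 0)
    (ε : ℕ) {N : ℕ} (hN : 2 * n ≤ N) :
    π (baileySum e ε α N) = π (e n) * π (e n) * π (∑ j ∈ range (n + 1), α j) := by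
  simp only [baileySum, mul_assoc (α _)]
  rw [map_sum_antidiagonal π (g := fun j u => e u * e (u + (2 * j + ε)))
    (c := π (e n) * π (e n)) hα (fun j u hu => ?_) hN]
  rw [map_mul, h.map_eq π hq hu, h.map_eq π hq (by omega : n ≤ u + (2 * j + ε))]

theorem isUnit_map (k : ℕ) : IsUnit (π (e k)) :=
  (IsUnit.of_mul_eq_one _ (h.mul_prod_one_sub k)).map π

variable [IsDomain R]

theorem map_sum_pow_mul (hq : π (q ^ (n + 1)) = 0) {ε : ℕ} {α : ℕ → R}
    (hα : ∀ n, baileySum e ε α n = if n = 0 then 1 else 0) :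
    π (∑ j ∈ range (n + 1), q ^ (j * (j + ε)) * e j) =
      π (e n) * π (∑ j ∈ range (n + 1), q ^ (j * (j + ε)) * (q ^ (j * (j + ε)) * α j)) := by
  have hpow (j : ℕ) (hj : n < j) : π (q ^ (j * (j + ε))) = 0 :=
    map_pow_eq_zero π hq (by nlinarith)
  have h₁ := congrArg π (h.sum_eq_baileySum hα (2 * n))
  rw [h.map_baileySum π hq (fun j hj => by rw [map_mul, hpow j hj, zero_mul]) ε le_rfl,
    mul_assoc] at h₁
  apply (h.isUnit_map π n).mul_left_cancel
  rw [← h₁, ← map_sum_antidiagonal π (g := fun _ u => e u)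
    (fun j hj => by rw [map_mul, hpow j hj, zero_mul]) (fun _ u hu => h.map_eq π hq hu) le_rfl]
  exact congrArg π (sum_congr rfl fun p _ => by ring)

theorem map_sum_thetaCoeff (hq : π (q ^ (n + 1)) = 0) {x y : R} (hx : x ≠ 0) (hq₀ : q ≠ 0)
    (hxy : x * y = q) (hπx : π (x ^ (n + 1)) = 0) (hπy : π (y ^ (n + 1)) = 0) {N : ℕ}
    (hN : 2 * n ≤ N) :
    π (∑ j ∈ range (n + 1), thetaCoeff q x y j) =
      π (∏ i ∈ range N, ((1 - x * q ^ i) * (1 - y * q ^ i) * (1 - q ^ (i + 1)))) := by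
  have h₁ := congrArg π (h.baileySum_thetaCoeff hx hq₀ hxy N)
  rw [h.map_baileySum π hq (fun j hj => ?_) 0 hN, map_mul, h.map_eq π hq (by omega : n ≤ 2 * N),
    mul_assoc] at h₁
  · apply (h.isUnit_map π n).mul_left_cancel
    rw [(h.isUnit_map π n).mul_left_cancel h₁,
      prod_mul_distrib (g := fun i => 1 - q ^ (i + 1)), map_mul, mul_left_comm,
      ← h.map_eq π hq (by omega : n ≤ N), ← map_mul π (e N), h.mul_prod_one_sub, map_one, mul_one]
  · rw [thetaCoeff, if_neg (by omega), map_mul, map_add, map_pow_eq_zero π hπx hj,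
      map_pow_eq_zero π hπy hj, add_zero, mul_zero]

end Truncation

end IsInvQFactorial

theorem prod_range_five_mul {M : Type*} [CommMonoid M] (f : ℕ → M) (N : ℕ) :
    ∏ i ∈ range (5 * N), f i =
      ∏ i ∈ range N,
        (f (5 * i) * f (5 * i + 1) * f (5 * i + 2) * f (5 * i + 3) * f (5 * i + 4)) := by
  induction N with
  | zero => simp
  | succ N ih =>
    rw [mul_add_one, prod_range_succ _ N, ← ih]
    simp only [prod_range_succ, mul_assoc]

section RogersRamanujan

variable {R A : Type*} [CommRing R] [IsDomain R] [CommRing A] {q : R} {e e' : ℕ → R}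
  (h : IsInvQFactorial q e) (h' : IsInvQFactorial (q ^ 5) e') (hq₀ : q ≠ 0) (π : R →+* A) {n : ℕ}
  (hq : π (q ^ (n + 1)) = 0)
include h h' hq₀ hq

theorem map_first_rogersRamanujan {N : ℕ} (hN : 2 * n ≤ N) :
    π (∑ j ∈ range (n + 1), q ^ (j * (j + 0)) * e j) *
      π (∏ i ∈ range N, ((1 - q ^ (5 * i + 1)) * (1 - q ^ (5 * i + 4)))) = 1 := by
  have hpow {k : ℕ} (hk : 1 ≤ k) : π ((q ^ k) ^ (n + 1)) = 0 := by
    rw [← pow_mul]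
    exact map_pow_eq_zero π hq (by nlinarith)
  have hθ (j : ℕ) : q ^ (j * (j + 0)) * (q ^ (j * (j + 0)) * thetaCoeff q 1 q j) =
      thetaCoeff (q ^ 5) (q ^ 2) (q ^ 3) j := by
    rcases eq_or_ne j 0 with rfl | hj
    · simp [thetaCoeff]
    · have hj₂ : j * (j + 0) = 2 * j.choose 2 + j := by
        rw [Nat.choose_two_right, Nat.mul_div_cancel' (Nat.even_mul_pred_self j).two_dvd]
        cases j <;> simp; ring
      rw [thetaCoeff, thetaCoeff, if_neg hj, if_neg hj, hj₂]
      ring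
  rw [h.map_sum_pow_mul π hq (h.baileySum_unit_zero hq₀)]
  simp only [hθ]
  rw [h'.map_sum_thetaCoeff π (hpow (by norm_num)) (pow_ne_zero 2 hq₀) (pow_ne_zero 5 hq₀)
    (by ring) (hpow (by norm_num)) (hpow (by norm_num)) hN, ← h.map_eq π hq (by omega : n ≤ 5 * N),
    ← map_mul, ← map_mul, mul_assoc, ← prod_mul_distrib]
  refine Eq.trans ?_ ((congrArg π (h.mul_prod_one_sub (5 * N))).trans (map_one π))
  rw [prod_range_five_mul]
  congr 2
  exact prod_congr rfl fun i _ => by ring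

theorem map_second_rogersRamanujan {N : ℕ} (hN : 2 * n ≤ N) :
    π (∑ j ∈ range (n + 1), q ^ (j * (j + 1)) * e j) *
      π (∏ i ∈ range N, ((1 - q ^ (5 * i + 2)) * (1 - q ^ (5 * i + 3)))) = 1 := by
  have hpow {k : ℕ} (hk : 1 ≤ k) : π ((q ^ k) ^ (n + 1)) = 0 := by
    rw [← pow_mul]
    exact map_pow_eq_zero π hq (by nlinarith)
  have hθ (m : ℕ) : ∑ j ∈ range (m + 1), q ^ (j * (j + 1)) * (q ^ (j * (j + 1)) *
        ((-1) ^ j * q ^ j.choose 2 * (1 - q ^ (2 * j + 1)))) =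
      ∑ j ∈ range (m + 1), thetaCoeff (q ^ 5) (q ^ 1) (q ^ 4) j -
        (-1) ^ m * (q ^ 5) ^ (m + 1).choose 2 * (q ^ 1) ^ (m + 1) := by
    induction m with
    | zero => simp [thetaCoeff]
    | succ m ih =>
      have hm : (m + 1) * (m + 1 + 1) = 2 * (m + 1).choose 2 + 2 * (m + 1) := by
        rw [Nat.choose_two_right, Nat.mul_div_cancel' (Nat.even_mul_pred_self _).two_dvd]
        simp; ring
      rw [sum_range_succ, ih, sum_range_succ _ (m + 1), thetaCoeff, if_neg m.succ_ne_zero, hm,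
        Nat.choose_succ_succ' (m + 1) 1, Nat.choose_one_right]
      ring
  rw [h.map_sum_pow_mul π hq h.baileySum_unit_one, hθ, map_sub, map_mul π _ ((q ^ 1) ^ (n + 1)),
    hpow le_rfl, mul_zero, sub_zero]
  rw [h'.map_sum_thetaCoeff π (hpow (by norm_num)) (pow_ne_zero 1 hq₀) (pow_ne_zero 5 hq₀)
    (by ring) (hpow (by norm_num)) (hpow (by norm_num)) hN, ← h.map_eq π hq (by omega : n ≤ 5 * N),
    ← map_mul, ← map_mul, mul_assoc, ← prod_mul_distrib]
  refine Eq.trans ?_ ((congrArg π (h.mul_prod_one_sub (5 * N))).trans (map_one π))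
  rw [prod_range_five_mul]
  congr 2
  exact prod_congr rfl fun i _ => by ring

end RogersRamanujan

section WeightedCount

open PowerSeries

variable {α β ι : Type*}

/-- The generating function counting the elements of `S` by their weight `w`. -/
noncomputable def genFun (S : Set α) (w : α → ℕ) : ℚ⟦X⟧ :=
  mk fun n => ({a ∈ S | w a = n}.ncard : ℚ)

theorem ncard_eq_sum_fiber [DecidableEq ι] {S : Set α} (hS : S.Finite) {φ : α → ι} {I : Finset ι}
    (h : ∀ a ∈ S, φ a ∈ I) : S.ncard = ∑ i ∈ I, {a ∈ S | φ a = i}.ncard := by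
  classical
  rw [Set.ncard_eq_toFinset_card S hS,
    card_eq_sum_card_fiberwise (f := φ) (t := I) fun a ha => h a (by simpa using ha)]
  refine sum_congr rfl fun i _ => ?_
  rw [← Set.ncard_coe_finset]
  congr 1
  ext a
  simp

theorem genFun_eq_sum_fiber [DecidableEq ι] {S : Set α} {w : α → ℕ}
    (hS : ∀ n, {a ∈ S | w a = n}.Finite) {φ : α → ι} {I : Finset ι} (h : ∀ a ∈ S, φ a ∈ I) :
    genFun S w = ∑ i ∈ I, genFun {a ∈ S | φ a = i} w := by
  ext n
  simp only [genFun, map_sum, coeff_mk]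
  rw [ncard_eq_sum_fiber (hS n) (φ := φ) fun a ha => h a ha.1, Nat.cast_sum]
  refine sum_congr rfl fun i _ => ?_
  congr 3
  ext a
  simp only [Set.mem_ofPred_eq]
  tauto

theorem genFun_bijOn {S : Set α} {T : Set β} {w : α → ℕ} {v : β → ℕ} {f : α → β} (d : ℕ)
    (hf : Set.BijOn f S T) (hw : ∀ a ∈ S, v (f a) = w a + d) :
    genFun T v = X ^ d * genFun S w := by
  ext n
  rw [coeff_X_pow_mul']
  simp only [genFun, coeff_mk]
  have key (n : ℕ) : {b ∈ T | v b = n} = f '' {a ∈ S | w a + d = n} := by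
    ext b
    simp only [Set.mem_ofPred_eq, Set.mem_image]
    constructor
    · rintro ⟨hb, rfl⟩
      obtain ⟨a, ha, rfl⟩ := hf.surjOn hb
      exact ⟨a, ⟨ha, (hw a ha).symm⟩, rfl⟩
    · rintro ⟨a, ⟨ha, rfl⟩, rfl⟩
      exact ⟨hf.mapsTo ha, hw a ha⟩
  rw [key, (hf.injOn.mono fun a ha => ha.1).ncard_image]
  split_ifs with hd
  · obtain ⟨k, rfl⟩ := Nat.exists_eq_add_of_le' hd
    simp
  · rw [show {a ∈ S | w a + d = n} = ∅ from Set.eq_empty_of_forall_notMem fun a ha => by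
      have := ha.2
      omega]
    simp

theorem genFun_prod {S : Set α} {T : Set β} {w : α → ℕ} {v : β → ℕ}
    (hS : ∀ n, {a ∈ S | w a = n}.Finite) (hT : ∀ n, {b ∈ T | v b = n}.Finite) :
    genFun (S ×ˢ T) (fun p => w p.1 + v p.2) = genFun S w * genFun T v := by
  have key (n : ℕ) (i : ℕ × ℕ) (hi : i ∈ antidiagonal n) :
      {p ∈ {p ∈ S ×ˢ T | w p.1 + v p.2 = n} | (w p.1, v p.2) = i} =
        {a ∈ S | w a = i.1} ×ˢ {b ∈ T | v b = i.2} := by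
    rw [HasAntidiagonal.mem_antidiagonal] at hi
    ext p
    simp only [Set.mem_ofPred_eq, Set.mem_prod, Prod.ext_iff]
    constructor
    · tauto
    · rintro ⟨⟨h₁, h₂⟩, h₃, h₄⟩
      exact ⟨⟨⟨h₁, h₃⟩, by omega⟩, h₂, h₄⟩
  ext n
  simp only [genFun, coeff_mul, coeff_mk]
  rw [ncard_eq_sum_fiber (φ := fun p => (w p.1, v p.2)) (I := antidiagonal n) ?_ fun p hp =>
    HasAntidiagonal.mem_antidiagonal.mpr hp.2, Nat.cast_sum]
  · refine sum_congr rfl fun i hi => ?_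
    rw [key n i hi, Set.ncard_prod, Nat.cast_mul]
  · refine ((antidiagonal n).finite_toSet.biUnion fun i _ => (hS i.1).prod (hT i.2)).subset ?_
    intro p hp
    simp only [Set.mem_iUnion]
    exact ⟨(w p.1, v p.2), by simpa using hp.2, ⟨hp.1.1, rfl⟩, hp.1.2, rfl⟩

end WeightedCount

section Recurrence

open PowerSeries

variable {R : Type*} [CommRing R] {q : R}

theorem IsInvQFactorial.one_sub_X_mul {e : ℕ → R} (h : IsInvQFactorial q e) :
    (1 - X) * PowerSeries.mk e = rescale q (PowerSeries.mk e) := by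
  ext n
  rw [sub_mul, one_mul, map_sub, coeff_rescale, coeff_mk]
  cases n with
  | zero => simp
  | succ n =>
    rw [coeff_succ_X_mul, coeff_mk, ← h.succ n]
    ring

variable [IsDomain R]

theorem eq_zero_of_mul_eq_rescale {a : R} (ha : ∀ k, 1 - a ^ (k + 1) ≠ 0) {P T : R⟦X⟧}
    (hP : constantCoeff P = 1) (hT : constantCoeff T = 0) (h : P * T = rescale a T) : T = 0 := by
  ext n
  rw [map_zero]
  induction n using Nat.strong_induction_on with
  | _ n ih =>
  cases n with
  | zero => simpa using hT
  | succ n =>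
    have h₁ := congrArg (coeff (n + 1)) h
    rw [coeff_rescale, coeff_mul, sum_eq_single (0, n + 1), coeff_zero_eq_constantCoeff_apply, hP,
      one_mul] at h₁
    · refine (mul_eq_zero.mp ?_).resolve_left (ha n)
      rw [sub_mul, one_mul, ← h₁, sub_self]
    · rintro ⟨i, j⟩ hij hne
      rw [HasAntidiagonal.mem_antidiagonal] at hij
      have : i ≠ 0 := by
        rintro rfl
        simp_all
      simp only at hij
      rw [ih j (by omega), mul_zero]
    · simp

/-- If `b` and `c` satisfy the recurrences below, then the convolutions of `a` with `c` and `b`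
are `1 / (q; q)_m` and `q ^ m / (q; q)_m`. -/
theorem IsInvQFactorial.convolution {e a b c : ℕ → R} (h : IsInvQFactorial q e) (ha₀ : a 0 = 1)
    (ha : ∀ k, (1 - q ^ (2 * (k + 1))) * a (k + 1) = q ^ (2 * k + 1) * a k)
    (hb₀ : b 0 = 1) (hc₀ : c 0 = 1) (hc : ∀ k, c (k + 1) = b (k + 1) + c k)
    (hb₁ : b 1 = q ^ 2 * c 1) (hb : ∀ k, b (k + 2) = q ^ (2 * (k + 2)) * c (k + 2) + q ^ 2 * b k)
    (m : ℕ) :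
    ∑ p ∈ antidiagonal m, a p.1 * c p.2 = e m ∧
      ∑ p ∈ antidiagonal m, a p.1 * b p.2 = q ^ m * e m := by
  have hq (k : ℕ) : 1 - (q ^ 2) ^ (k + 1) ≠ 0 := by
    rw [← pow_mul]
    exact h.ne (2 * k + 1)
  have ha' : PowerSeries.mk a = (1 + C q * X) * rescale (q ^ 2) (PowerSeries.mk a) := by
    ext n
    rw [add_mul, one_mul, map_add, mul_assoc, coeff_C_mul]
    cases n with
    | zero => simp
    | succ n =>
      rw [coeff_succ_X_mul, coeff_rescale, coeff_rescale, coeff_mk, coeff_mk]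
      linear_combination ha n
  have hc' : PowerSeries.mk b = (1 - X) * PowerSeries.mk c := by
    ext n
    rw [sub_mul, one_mul, map_sub]
    cases n with
    | zero => simp [hb₀, hc₀]
    | succ n => rw [coeff_succ_X_mul]; simp [hc]
  have hb' : PowerSeries.mk b * (1 - C (q ^ 2) * X ^ 2) = rescale (q ^ 2) (PowerSeries.mk c) := by
    ext n
    rw [mul_sub, mul_one, mul_left_comm, map_sub, coeff_C_mul, mul_comm, coeff_rescale]
    match n with
    | 0 => simp [hb₀, hc₀, coeff_mul_X_pow']
    | 1 => simp [hb₁, coeff_mul_X_pow']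
    | n + 2 =>
      rw [coeff_mul_X_pow, coeff_mk, coeff_mk, coeff_mk, hb]
      ring
  have he : (1 - X) * (1 - C q * X) * PowerSeries.mk e = rescale (q ^ 2) (PowerSeries.mk e) := by
    rw [pow_two, ← rescale_rescale, ← h.one_sub_X_mul, map_mul, ← h.one_sub_X_mul]
    simp [rescale_X]
    ring
  have hs : (1 - X) * (1 - C q * X) * (PowerSeries.mk a * PowerSeries.mk c) =
      rescale (q ^ 2) (PowerSeries.mk a * PowerSeries.mk c) := by
    rw [map_mul, ← hb', hc', map_pow]
    nth_rw 1 [ha']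
    ring
  have hS : PowerSeries.mk a * PowerSeries.mk c = PowerSeries.mk e := by
    rw [← sub_eq_zero]
    refine eq_zero_of_mul_eq_rescale hq (P := (1 - X) * (1 - C q * X)) (by simp)
      (by simp [ha₀, hc₀, h.zero]) ?_
    rw [mul_sub, he, hs, map_sub]
  have hB : PowerSeries.mk a * PowerSeries.mk b = rescale q (PowerSeries.mk e) := by
    rw [hc', mul_left_comm, hS, h.one_sub_X_mul]
  have h₁ := congrArg (coeff m) hS
  have h₂ := congrArg (coeff m) hB
  simp only [coeff_mul, coeff_mk, coeff_rescale] at h₁ h₂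
  exact ⟨h₁, h₂⟩

end Recurrence

section Multisets

open PowerSeries

theorem finite_card_eq (S : Set (Multiset ℕ)) (k n : ℕ)
    (hS : ∀ s ∈ S, Multiset.card s = k ∧ s.sum ≤ n) : S.Finite := by
  refine (Set.finite_Iic (k • Multiset.range (n + 1))).subset fun s hs => ?_
  rw [Set.mem_Iic, Multiset.le_iff_count]
  intro x
  by_cases hx : x ∈ s
  · have h₁ := (Multiset.single_le_sum (fun _ _ => Nat.zero_le _) x hx).trans (hS s hs).2
    rw [Multiset.count_nsmul, Multiset.count_eq_one_of_mem (Multiset.nodup_range _)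
      (by rw [Multiset.mem_range]; omega), mul_one, ← (hS s hs).1]
    exact Multiset.count_le_card x s
  · rw [Multiset.count_eq_zero_of_notMem hx]
    exact Nat.zero_le _

theorem bijOn_replicate_zero_add_map_succ (t : ℕ) :
    Set.BijOn (fun s : Multiset ℕ => Multiset.replicate t 0 + s.map Nat.succ) Set.univ
      {s | s.count 0 = t} := by
  refine ⟨fun s _ => ?_, fun s _ s' _ hs => ?_, fun s hs => ⟨(s.filter (· ≠ 0)).map Nat.pred,
    Set.mem_univ _, ?_⟩⟩
  · simp [Multiset.count_eq_zero_of_notMem]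
  · exact Multiset.map_injective Nat.succ_injective (add_left_cancel hs)
  · have hs : s.count 0 = t := hs
    have h₁ : ((s.filter (· ≠ 0)).map Nat.pred).map Nat.succ = s.filter (· ≠ 0) := by
      rw [Multiset.map_map]
      refine (Multiset.map_congr rfl fun x hx => ?_).trans (Multiset.map_id _)
      exact Nat.succ_pred (Multiset.mem_filter.mp hx).2
    simp only [h₁]
    rw [← hs, ← Multiset.filter_eq', Multiset.filter_add_not]

/-- The multisets of `k` natural numbers containing at most `r` zeros, in which any two
consecutive values occur at most twice in total. -/
def gapSet (r k : ℕ) : Set (Multiset ℕ) :=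
  {s | Multiset.card s = k ∧ s.count 0 ≤ r ∧ ∀ y, s.count y + s.count (y + 1) ≤ 2}

/-- The generating function of the odd parts `2 y + 1` for `y` in an element of `gapSet r k`. -/
noncomputable def gapGenFun (r k : ℕ) : ℚ⟦X⟧ :=
  genFun (gapSet r k) fun s => 2 * s.sum + Multiset.card s

theorem finite_gapSet_fiber (r k n : ℕ) :
    {s ∈ gapSet r k | 2 * s.sum + Multiset.card s = n}.Finite :=
  finite_card_eq _ k n fun s hs => ⟨hs.1.1, by have := hs.2; omega⟩

theorem bijOn_gapSet {t : ℕ} (ht : t ≤ 2) (k : ℕ) :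
    Set.BijOn (fun s : Multiset ℕ => Multiset.replicate t 0 + s.map Nat.succ)
      (gapSet (2 - t) k) {s ∈ gapSet t (k + t) | s.count 0 = t} := by
  have h := bijOn_replicate_zero_add_map_succ t
  have hsucc (s : Multiset ℕ) (y : ℕ) :
      (Multiset.replicate t 0 + s.map Nat.succ).count (y + 1) = s.count y := by
    rw [Multiset.count_add, Multiset.count_replicate, if_neg (by omega), zero_add]
    exact Multiset.count_map_eq_count' _ _ Nat.succ_injective y
  have hzero (s : Multiset ℕ) : (Multiset.replicate t 0 + s.map Nat.succ).count 0 = t :=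
    h.mapsTo (Set.mem_univ s)
  have hiff (s : Multiset ℕ) : s ∈ gapSet (2 - t) k ↔
      Multiset.replicate t 0 + s.map Nat.succ ∈ gapSet t (k + t) := by
    have hcard : Multiset.card (Multiset.replicate t 0 + s.map Nat.succ) =
        Multiset.card s + t := by
      simp [add_comm]
    simp only [gapSet, Set.mem_ofPred_eq, hcard, hzero, add_left_inj, le_refl, true_and]
    refine and_congr_right fun _ => ⟨fun ⟨h₁, h₂⟩ y => ?_, fun h₁ => ⟨?_, fun y => ?_⟩⟩
    · cases y with
      | zero => rw [hzero, hsucc]; omega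
      | succ y => rw [hsucc, hsucc]; exact h₂ y
    · have := h₁ 0
      rw [hzero, hsucc] at this
      omega
    · have := h₁ (y + 1)
      rwa [hsucc, hsucc] at this
  refine ⟨fun s hs => ⟨(hiff s).mp hs, hzero s⟩, h.injOn.mono (Set.subset_univ _), fun s hs => ?_⟩
  obtain ⟨s', -, rfl⟩ := h.surjOn hs.2
  exact ⟨s', (hiff s').mpr hs.1, rfl⟩

theorem genFun_gapSet_fiber {t : ℕ} (ht : t ≤ 2) (k : ℕ) :
    genFun {s ∈ gapSet t (k + t) | s.count 0 = t} (fun s => 2 * s.sum + Multiset.card s) =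
      X ^ (2 * k + t) * gapGenFun (2 - t) k := by
  refine genFun_bijOn _ (bijOn_gapSet ht k) fun s hs => ?_
  have : (s.map Nat.succ).sum = s.sum + Multiset.card s := by
    simp [Nat.succ_eq_add_one, Multiset.sum_map_add]
  have := hs.1
  simp_all
  ring

theorem gapGenFun_zero_left (k : ℕ) : gapGenFun 0 k = X ^ (2 * k) * gapGenFun 2 k := by
  rw [← Nat.sub_zero 2, ← Nat.add_zero (2 * k), ← genFun_gapSet_fiber (Nat.zero_le 2) k, gapGenFun]
  congr 1
  ext s
  exact ⟨fun h => ⟨h, Nat.le_zero.mp h.2.1⟩, fun h => h.1⟩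

theorem gapGenFun_succ_left (r k : ℕ) : gapGenFun (r + 1) k = gapGenFun r k +
    genFun {s ∈ gapSet (r + 1) k | s.count 0 = r + 1} fun s => 2 * s.sum + Multiset.card s := by
  rw [gapGenFun, genFun_eq_sum_fiber (finite_gapSet_fiber _ _)
    (φ := fun s => decide (s.count 0 = r + 1)) (I := univ) fun _ _ => mem_univ _,
    Fintype.sum_bool, add_comm, gapGenFun]
  congr 2
  · ext s
    simp only [gapSet, Set.mem_ofPred_eq, decide_eq_false_iff_not]
    refine ⟨fun h => ⟨h.1.1, by omega, h.1.2.2⟩, fun h => ⟨⟨h.1, by omega, h.2.2⟩, by omega⟩⟩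
  · ext s
    simp

theorem gapGenFun_one_succ (k : ℕ) :
    gapGenFun 1 (k + 1) = gapGenFun 0 (k + 1) + X ^ (2 * k + 1) * gapGenFun 1 k :=
  (gapGenFun_succ_left 0 (k + 1)).trans (congrArg _ (genFun_gapSet_fiber one_le_two k))

theorem gapGenFun_two_add_two (k : ℕ) :
    gapGenFun 2 (k + 2) = gapGenFun 1 (k + 2) + X ^ (2 * k + 2) * gapGenFun 0 k := by
  rw [gapGenFun_succ_left, genFun_gapSet_fiber le_rfl]

theorem gapGenFun_two_one : gapGenFun 2 1 = gapGenFun 1 1 := by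
  rw [gapGenFun, gapGenFun]
  congr 1
  ext s
  refine and_congr_right fun h => and_congr_left fun _ => ?_
  have := Multiset.count_le_card 0 s
  omega

theorem genFun_singleton {α : Type*} (a : α) {w : α → ℕ} (hw : w a = 0) : genFun {a} w = 1 := by
  ext n
  rw [coeff_one, genFun, coeff_mk]
  split_ifs with hn
  · rw [show {b ∈ ({a} : Set α) | w b = n} = {a} by ext b; simp +contextual [hn, hw]]
    simp
  · rw [show {b ∈ ({a} : Set α) | w b = n} = ∅ by
      ext b
      simp only [Set.mem_ofPred_eq, Set.mem_singleton_iff, Set.mem_empty_iff_false, iff_false]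
      rintro ⟨rfl, rfl⟩; exact hn hw]
    simp

theorem gapGenFun_zero_right (r : ℕ) : gapGenFun r 0 = 1 := by
  rw [gapGenFun, show gapSet r 0 = {0} by ext s; simp +contextual [gapSet], genFun_singleton]
  simp

/-- The generating function of the even numbers `2 y` for `y` in a multiset of `c` elements. -/
noncomputable def evenGenFun (c : ℕ) : ℚ⟦X⟧ :=
  genFun {s : Multiset ℕ | Multiset.card s = c} fun s => 2 * s.sum

theorem evenGenFun_zero : evenGenFun 0 = 1 := by
  rw [evenGenFun, show {s : Multiset ℕ | Multiset.card s = 0} = {0} by ext s; simp,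
    genFun_singleton]
  simp

theorem evenGenFun_succ (c : ℕ) :
    (1 - X ^ (2 * (c + 1))) * evenGenFun (c + 1) = evenGenFun c := by
  have h₁ : genFun {s ∈ {s : Multiset ℕ | Multiset.card s = c + 1} | decide (0 ∈ s) = true}
      (fun s => 2 * s.sum) = X ^ 0 * evenGenFun c := by
    refine genFun_bijOn (f := fun s => 0 ::ₘ s) 0 ⟨fun s hs => ?_, fun s _ s' _ hs => ?_,
      fun s hs => ?_⟩ fun s _ => by simp
    · simpa using hs
    · simpa using hs
    · obtain ⟨s', rfl⟩ := Multiset.exists_cons_of_mem (of_decide_eq_true hs.2)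
      exact ⟨s', by simpa using hs.1, rfl⟩
  have h₂ : genFun {s ∈ {s : Multiset ℕ | Multiset.card s = c + 1} | decide (0 ∈ s) = false}
      (fun s => 2 * s.sum) = X ^ (2 * (c + 1)) * evenGenFun (c + 1) := by
    have h := bijOn_replicate_zero_add_map_succ 0
    refine genFun_bijOn (f := fun s => Multiset.replicate 0 0 + s.map Nat.succ) (2 * (c + 1))
      ⟨fun s hs => ?_, h.injOn.mono (Set.subset_univ _), fun s hs => ?_⟩ fun s hs => ?_
    · simpa using hs
    · obtain ⟨s', -, rfl⟩ := h.surjOn (Multiset.count_eq_zero.mpr (of_decide_eq_false hs.2))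
      exact ⟨s', by simpa using hs.1, rfl⟩
    · have hs : Multiset.card s = c + 1 := hs
      simp [Nat.succ_eq_add_one, Multiset.sum_map_add, hs]
      ring
  have h₃ := genFun_eq_sum_fiber (S := {s : Multiset ℕ | Multiset.card s = c + 1})
    (w := fun s => 2 * s.sum) (fun n => finite_card_eq _ (c + 1) n fun s hs =>
      ⟨hs.1, by have := hs.2; omega⟩) (φ := fun s => decide (0 ∈ s)) (I := univ)
    fun _ _ => mem_univ _
  rw [Fintype.sum_bool, h₁, h₂, pow_zero, one_mul] at h₃
  rw [sub_mul, one_mul, sub_eq_iff_eq_add, ← h₃, evenGenFun]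

end Multisets

section EvenOdd

open PowerSeries

theorem isUnit_one_sub_X_pow (k : ℕ) : IsUnit (1 - X ^ (k + 1) : ℚ⟦X⟧) := by
  rw [isUnit_iff_constantCoeff]
  simp

theorem X_pow_mul_self_dvd_gapGenFun (k : ℕ) :
    X ^ (k * k) ∣ gapGenFun 0 k ∧ X ^ (k * k) ∣ gapGenFun 1 k := by
  induction k using Nat.strong_induction_on with
  | _ k ih =>
  cases k with
  | zero => simp
  | succ k =>
    obtain ⟨c, hc⟩ := (ih k k.lt_succ_self).2
    have h₀ : X ^ ((k + 1) * (k + 1)) ∣ gapGenFun 0 (k + 1) := by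
      rw [← (isUnit_one_sub_X_pow (2 * k + 1)).dvd_mul_left]
      cases k with
      | zero =>
        refine ⟨X ^ 2 * c, ?_⟩
        have h₁ := gapGenFun_zero_left 1
        rw [gapGenFun_two_one, gapGenFun_one_succ, hc] at h₁
        linear_combination h₁
      | succ k =>
        obtain ⟨b, hb⟩ := (ih k (by omega)).1
        refine ⟨X ^ (2 * (k + 2)) * c + X ^ 2 * b, ?_⟩
        have h₁ := gapGenFun_zero_left (k + 2)
        rw [gapGenFun_two_add_two, gapGenFun_one_succ, hc, hb] at h₁
        linear_combination h₁
    refine ⟨h₀, ?_⟩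
    rw [gapGenFun_one_succ, hc]
    exact dvd_add h₀ ⟨c, by ring⟩

theorem IsInvQFactorial.sum_gapGenFun {e : ℕ → ℚ⟦X⟧} (h : IsInvQFactorial X e) (m : ℕ) :
    ∑ p ∈ antidiagonal m, X ^ (2 * m * p.1) * (evenGenFun p.1 * gapGenFun 1 p.2) =
        X ^ (m * (m + 0)) * e m ∧
      ∑ p ∈ antidiagonal m, X ^ (2 * m * p.1) * (evenGenFun p.1 * gapGenFun 0 p.2) =
        X ^ (m * (m + 1)) * e m := by
  choose b hb using fun k => (X_pow_mul_self_dvd_gapGenFun k).1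
  choose c hc using fun k => (X_pow_mul_self_dvd_gapGenFun k).2
  have hX (k : ℕ) : (X ^ k : ℚ⟦X⟧) ≠ 0 := pow_ne_zero _ X_ne_zero
  have hb₀ : b 0 = 1 := by simpa [gapGenFun_zero_right] using (hb 0).symm
  have hc₀ : c 0 = 1 := by simpa [gapGenFun_zero_right] using (hc 0).symm
  have key := h.convolution (a := fun k => X ^ (k * k) * evenGenFun k) (b := b) (c := c)
    (by simp [evenGenFun_zero]) (fun k => ?_) hb₀ hc₀ (fun k => ?_) ?_ (fun k => ?_) m
  · have hsum {g d : ℕ → ℚ⟦X⟧} (hg : ∀ k, g k = X ^ (k * k) * d k) :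
        ∑ p ∈ antidiagonal m, X ^ (2 * m * p.1) * (evenGenFun p.1 * g p.2) =
          X ^ (m * m) * ∑ p ∈ antidiagonal m, X ^ (p.1 * p.1) * evenGenFun p.1 * d p.2 := by
      rw [mul_sum]
      refine sum_congr rfl fun p hp => ?_
      rw [← HasAntidiagonal.mem_antidiagonal.mp hp, hg]
      ring
    rw [hsum hb, hsum hc, key.1, key.2]
    exact ⟨rfl, by ring⟩
  · rw [← evenGenFun_succ k]
    ring
  · apply mul_left_cancel₀ (hX ((k + 1) * (k + 1)))
    have h₁ := gapGenFun_one_succ k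
    rw [hb, hc, hc] at h₁
    linear_combination h₁
  · have h₁ := gapGenFun_zero_left 1
    rw [gapGenFun_two_one, hb, hc] at h₁
    apply mul_left_cancel₀ (hX 1)
    linear_combination h₁
  · have h₁ := gapGenFun_zero_left (k + 2)
    rw [gapGenFun_two_add_two, hb, hb, hc] at h₁
    apply mul_left_cancel₀ (hX ((k + 2) * (k + 2)))
    linear_combination h₁

/-- The multisets of `m` numbers with at most `r` ones, whose even elements are at least `2 m`, and
in which any two consecutive odd values occur at most twice in total. -/
def evenOddSet (r m : ℕ) : Set (Multiset ℕ) :=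
  {s | Multiset.card s = m ∧ s.count 1 ≤ r ∧ (∀ x ∈ s, Even x → 2 * m ≤ x) ∧
    ∀ y, s.count (2 * y + 1) + s.count (2 * (y + 1) + 1) ≤ 2}

theorem bijOn_evenOddSet (r c k : ℕ) :
    Set.BijOn (fun p : Multiset ℕ × Multiset ℕ =>
        p.1.map (fun y => 2 * y + 2 * (c + k)) + p.2.map (fun y => 2 * y + 1))
      ({s | Multiset.card s = c} ×ˢ gapSet r k)
      {s ∈ evenOddSet r (c + k) | (Multiset.card (s.filter (fun x => Even x)),
        Multiset.card (s.filter (fun x => ¬ Even x))) = (c, k)} := by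
  have hinj : Function.Injective fun y : ℕ => 2 * y + 1 := fun a b hab => by
    simp only at hab; omega
  have hinj' : Function.Injective fun y : ℕ => 2 * y + 2 * (c + k) := fun a b hab => by
    simp only at hab; omega
  have heven (E O : Multiset ℕ) : (E.map (fun y => 2 * y + 2 * (c + k)) +
      O.map (fun y => 2 * y + 1)).filter (fun x => Even x) =
        E.map (fun y => 2 * y + 2 * (c + k)) := by
    rw [Multiset.filter_add, Multiset.filter_eq_self.mpr, Multiset.filter_eq_nil.mpr, add_zero]
    · simp
    · simp [← mul_add]
  have hodd (E O : Multiset ℕ) : (E.map (fun y => 2 * y + 2 * (c + k)) +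
      O.map (fun y => 2 * y + 1)).filter (fun x => ¬ Even x) = O.map (fun y => 2 * y + 1) := by
    rw [Multiset.filter_add, Multiset.filter_eq_nil.mpr, Multiset.filter_eq_self.mpr, zero_add]
    · simp
    · simp [← mul_add]
  have hcount (E O : Multiset ℕ) (y : ℕ) : (E.map (fun y => 2 * y + 2 * (c + k)) +
      O.map (fun y => 2 * y + 1)).count (2 * y + 1) = O.count y := by
    rw [Multiset.count_add, Multiset.count_eq_zero_of_notMem, zero_add]
    · exact Multiset.count_map_eq_count' _ _ hinj y
    · simp only [Multiset.mem_map, not_exists, not_and]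
      intros
      omega
  refine ⟨fun p hp => ?_, fun p _ p' _ hpp' => ?_, fun s hs => ?_⟩
  · obtain ⟨h₁, h₂, h₃, h₄⟩ := hp
    rw [Set.mem_ofPred_eq] at h₁
    refine ⟨⟨by simp [h₁, h₂], ?_, fun x hx hx' => ?_, fun y => ?_⟩, ?_⟩
    · rw [← hcount p.1 p.2] at h₃
      exact h₃
    · have := Multiset.mem_filter.mpr ⟨hx, hx'⟩
      rw [heven] at this
      simp only [Multiset.mem_map] at this
      omega
    · simp only [hcount]
      exact h₄ y
    · simp only [heven, hodd, Multiset.card_map, h₁, h₂]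
  · have h₁ := congrArg (Multiset.filter (fun x => Even x)) hpp'
    have h₂ := congrArg (Multiset.filter (fun x => ¬ Even x)) hpp'
    simp only [heven, hodd] at h₁ h₂
    exact Prod.ext (Multiset.map_injective hinj' h₁) (Multiset.map_injective hinj h₂)
  · obtain ⟨⟨h₁, h₂, h₃, h₄⟩, h₅⟩ := hs
    obtain ⟨E, hE⟩ : ∃ E : Multiset ℕ,
        E.map (fun y => 2 * y + 2 * (c + k)) = s.filter (fun x => Even x) := by
      refine ⟨(s.filter (fun x => Even x)).map fun x => x / 2 - (c + k), ?_⟩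
      rw [Multiset.map_map]
      refine (Multiset.map_congr rfl fun x hx => ?_).trans (Multiset.map_id _)
      obtain ⟨hx, hx'⟩ := Multiset.mem_filter.mp hx
      have := h₃ x hx hx'
      obtain ⟨y, rfl⟩ := hx'
      simp only [Function.comp_apply, id_eq]
      omega
    obtain ⟨O, hO⟩ : ∃ O : Multiset ℕ,
        O.map (fun y => 2 * y + 1) = s.filter (fun x => ¬ Even x) := by
      refine ⟨(s.filter (fun x => ¬ Even x)).map fun x => x / 2, ?_⟩
      rw [Multiset.map_map]
      refine (Multiset.map_congr rfl fun x hx => ?_).trans (Multiset.map_id _)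
      obtain ⟨y, rfl⟩ := Nat.not_even_iff_odd.mp (Multiset.mem_filter.mp hx).2
      simp only [Function.comp_apply, id_eq]
      omega
    have hs : E.map (fun y => 2 * y + 2 * (c + k)) + O.map (fun y => 2 * y + 1) = s := by
      rw [hE, hO, Multiset.filter_add_not]
    rw [← hE, ← hO, Multiset.card_map, Multiset.card_map, Prod.mk_inj] at h₅
    simp only [← hs, hcount] at h₄
    have h₆ := hcount E O 0
    rw [hs, mul_zero, zero_add] at h₆
    exact ⟨(E, O), ⟨h₅.1, h₅.2, h₆ ▸ h₂, h₄⟩, hs⟩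

theorem genFun_evenOddSet (r m : ℕ) :
    genFun (evenOddSet r m) Multiset.sum =
      ∑ p ∈ antidiagonal m, X ^ (2 * m * p.1) * (evenGenFun p.1 * gapGenFun r p.2) := by
  rw [genFun_eq_sum_fiber
    (fun n => finite_card_eq _ m n fun s hs => ⟨hs.1.1, hs.2.le⟩)
    (φ := fun s => (Multiset.card (s.filter (fun x => Even x)),
      Multiset.card (s.filter (fun x => ¬ Even x)))) (I := antidiagonal m)]
  · refine sum_congr rfl fun p hp => ?_
    obtain ⟨c, k⟩ := p
    rw [HasAntidiagonal.mem_antidiagonal] at hp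
    subst hp
    rw [evenGenFun, gapGenFun, ← genFun_prod]
    · refine genFun_bijOn _ (bijOn_evenOddSet r c k) fun p hp => ?_
      obtain ⟨h₁, h₂, -⟩ := hp
      rw [Set.mem_ofPred_eq] at h₁
      have hmul (s : Multiset ℕ) : (s.map fun y => 2 * y).sum = 2 * s.sum := by
        simpa using Multiset.sum_map_mul_left (s := s) (a := 2) (f := id)
      simp only [Multiset.sum_add, Multiset.sum_map_add, hmul, Multiset.map_const',
        Multiset.sum_replicate, h₁, h₂, smul_eq_mul]
      ring
    · exact fun n => finite_card_eq _ c n fun s hs => ⟨hs.1, by have := hs.2; omega⟩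
    · exact finite_gapSet_fiber r k
  · intro s hs
    rw [HasAntidiagonal.mem_antidiagonal, ← Multiset.card_add, Multiset.filter_add_not]
    exact hs.1

end EvenOdd

theorem card_filter_or {a b : ℕ} (hab : a ≠ b) (l : List ℕ) :
    (l.filter fun x => x = a ∨ x = b).length = l.count a + l.count b := by
  induction l with
  | nil => simp
  | cons c l ih =>
    rw [List.filter_cons, List.count_cons, List.count_cons]
    simp only [decide_eq_true_eq, beq_iff_eq]
    split_ifs <;> simp_all <;> omega

theorem gapCond_two_four_iff {l : List ℕ} (hl : l.Pairwise (· ≤ ·)) (hodd : ∀ x ∈ l, ¬ Even x) :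
    GapCond l 2 4 ↔ ∀ y, l.count (2 * y + 1) + l.count (2 * (y + 1) + 1) ≤ 2 := by
  have hmono {i j : ℕ} (hij : i ≤ j) (hj : j < l.length) : l[i] ≤ l[j] := by
    rcases hij.eq_or_lt with rfl | hij
    · exact le_rfl
    · exact List.pairwise_iff_getElem.mp hl i j _ _ hij
  constructor
  · intro h y
    by_contra! hy
    rw [← card_filter_or (by omega)] at hy
    obtain ⟨f, hf⟩ := List.sublist_iff_exists_fin_orderEmbedding_get_eq.mp
      (List.filter_sublist (p := fun x => x = 2 * y + 1 ∨ x = 2 * (y + 1) + 1) (l := l))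
    have hmem (i) : l.get (f i) = 2 * y + 1 ∨ l.get (f i) = 2 * (y + 1) + 1 := by
      rw [← hf]
      exact of_decide_eq_true (List.mem_filter.mp (List.get_mem _ i)).2
    have h₀₁ : (f ⟨0, by omega⟩ : ℕ) < f ⟨1, by omega⟩ := f.strictMono (by simp)
    have h₁₂ : (f ⟨1, by omega⟩ : ℕ) < f ⟨2, by omega⟩ := f.strictMono (by simp)
    have h₂ := (f ⟨2, hy⟩).isLt
    have h₃ := h (f ⟨0, by omega⟩) (by omega)
    rw [getElem!_pos l _ (by omega), getElem!_pos l _ (by omega)] at h₃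
    have h₄ := hmono (by omega : (f ⟨0, _⟩ : ℕ) + 2 ≤ f ⟨2, hy⟩) h₂
    have h₅ := hmem ⟨0, by omega⟩
    have h₆ := hmem ⟨2, hy⟩
    simp only [List.get_eq_getElem] at h₅ h₆
    omega
  · intro h ℓ hℓ
    rw [getElem!_pos l _ hℓ, getElem!_pos l _ (by omega)]
    by_contra! hlt
    obtain ⟨y, hy⟩ := Nat.not_even_iff_odd.mp (hodd _ (List.getElem_mem (by omega : ℓ < l.length)))
    have hval {i : ℕ} (h₁ : ℓ ≤ i) (h₂ : i ≤ ℓ + 2) :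
        l[i] = 2 * y + 1 ∨ l[i] = 2 * (y + 1) + 1 := by
      obtain ⟨z, hz⟩ := Nat.not_even_iff_odd.mp
        (hodd _ (List.getElem_mem (by omega : i < l.length)))
      have h₃ := hmono h₁ (by omega)
      have h₄ := hmono h₂ hℓ
      omega
    have hsub : [l[ℓ], l[ℓ + 1], l[ℓ + 2]].Sublist l := by
      have h₁ : l.drop ℓ = l[ℓ] :: l[ℓ + 1] :: l[ℓ + 2] :: l.drop (ℓ + 3) := by
        rw [List.drop_eq_getElem_cons (by omega), List.drop_eq_getElem_cons (by omega),
          List.drop_eq_getElem_cons (by omega)]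
      refine List.Sublist.trans ?_ (List.drop_sublist ℓ l)
      rw [h₁]
      exact (List.prefix_append [_, _, _] _).sublist
    have h₁ := (hsub.filter fun x => x = 2 * y + 1 ∨ x = 2 * (y + 1) + 1).length_le
    rw [card_filter_or (by omega) l, List.filter_eq_self.mpr] at h₁
    · have := h y
      simp only [List.length_cons, List.length_nil] at h₁
      omega
    · simp only [List.mem_cons, List.not_mem_nil, or_false, decide_eq_true_eq]
      rintro x (rfl | rfl | rfl)
      · exact hval le_rfl (by omega)
      · exact hval (by omega) (by omega)
      · exact hval (by omega) le_rfl

theorem gapCond_oddParts_iff {n : ℕ} (p : n.Partition) :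
    GapCond p.oddParts 2 4 ↔
      ∀ y, p.parts.count (2 * y + 1) + p.parts.count (2 * (y + 1) + 1) ≤ 2 := by
  rw [Nat.Partition.oddParts, gapCond_two_four_iff (Multiset.pairwise_sort _ _) fun x hx =>
    (Multiset.mem_filter.mp ((Multiset.mem_sort _).mp hx)).2]
  refine forall_congr' fun y => ?_
  rw [← Multiset.coe_count, ← Multiset.coe_count, Multiset.sort_eq, Multiset.count_filter_of_pos,
    Multiset.count_filter_of_pos]
  · simp
  · simp

/-- Partitions counted by `evenOddSet`. -/
theorem card_partition_eq_sum (n r : ℕ) :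
    Nat.card {p : n.Partition // Multiset.count 1 p.parts ≤ r ∧
      (∀ x ∈ p.parts, Even x → 2 * Multiset.card p.parts ≤ x) ∧ GapCond p.oddParts 2 4} =
    ∑ m ∈ range (n + 1), {s ∈ evenOddSet r m | s.sum = n}.ncard := by
  have hinj : Function.Injective (Nat.Partition.parts (n := n)) := fun _ _ => Nat.Partition.ext
  have hfin : {p : n.Partition | Multiset.count 1 p.parts ≤ r ∧
      (∀ x ∈ p.parts, Even x → 2 * Multiset.card p.parts ≤ x) ∧ GapCond p.oddParts 2 4}.Finite :=
    Set.toFinite _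
  rw [← Set.coe_ofPred, Nat.card_coe_set_eq, ncard_eq_sum_fiber hfin
    (φ := fun p => Multiset.card p.parts) (I := range (n + 1)) fun p _ => ?_]
  · refine sum_congr rfl fun m _ => ?_
    rw [← hinj.injOn.ncard_image]
    congr 1
    ext s
    simp only [Set.mem_image, Set.mem_ofPred_eq, gapCond_oddParts_iff, evenOddSet]
    constructor
    · rintro ⟨p, ⟨⟨h₁, h₂, h₃⟩, rfl⟩, rfl⟩
      exact ⟨⟨rfl, h₁, h₂, h₃⟩, p.parts_sum⟩
    · rintro ⟨⟨rfl, h₁, h₂, h₃⟩, h₄⟩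
      refine ⟨⟨s, fun {x} hx => Nat.pos_of_ne_zero ?_, h₄⟩, ⟨⟨h₁, h₂, h₃⟩, rfl⟩, rfl⟩
      rintro rfl
      have := h₂ 0 hx Even.zero
      have := Multiset.card_pos_iff_exists_mem.mpr ⟨0, hx⟩
      omega
  · have := Multiset.card_nsmul_le_sum (a := 1) fun x hx => p.parts_pos hx
    rw [p.parts_sum, smul_eq_mul, mul_one] at this
    exact mem_range_succ_iff.mpr this

section Restricted

open PowerSeries PowerSeries.WithPiTopology

theorem X_pow_dvd_restricted_mul_prod_sub_one (p : ℕ → Prop) [DecidablePred p] {n M : ℕ}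
    (hM : n ≤ M) :
    (X : ℚ⟦X⟧) ^ (n + 1) ∣ PowerSeries.mk (fun k => (#(Nat.Partition.restricted k p) : ℚ)) *
      (∏ i ∈ range M, if p (i + 1) then 1 - X ^ (i + 1) else 1) - 1 := by
  have hfactor (i : ℕ) : (if p (i + 1) then ∑' j : ℕ, X ^ ((i + 1) * j) else 1) *
      (if p (i + 1) then 1 - X ^ (i + 1) else 1) = (1 : ℚ⟦X⟧) := by
    split_ifs
    · simp only [pow_mul]
      exact tsum_pow_mul_one_sub_of_constantCoeff_eq_zero (by simp)
    · exact one_mul 1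
  have hprod (N : ℕ) (hN : M ≤ N) : (X : ℚ⟦X⟧) ^ (n + 1) ∣
      (∏ i ∈ range N, if p (i + 1) then ∑' j : ℕ, X ^ ((i + 1) * j) else 1) *
        (∏ i ∈ range M, if p (i + 1) then 1 - X ^ (i + 1) else 1) - 1 := by
    have h₁ : (X : ℚ⟦X⟧) ^ (n + 1) ∣ (∏ i ∈ range M, if p (i + 1) then 1 - X ^ (i + 1) else 1) -
        ∏ i ∈ range N, if p (i + 1) then 1 - X ^ (i + 1) else 1 := by
      induction N, hN using Nat.le_induction with
      | base => simp
      | succ N hN ih =>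
        rw [prod_range_succ]
        split_ifs
        · rw [mul_one_sub, ← sub_add]
          exact dvd_add ih ((pow_dvd_pow X (by omega)).mul_left _)
        · rwa [mul_one]
    refine (h₁.mul_left
      (∏ i ∈ range N, if p (i + 1) then ∑' j : ℕ, X ^ ((i + 1) * j) else 1)).trans (dvd_of_eq ?_)
    rw [mul_sub, ← prod_mul_distrib (s := range N), prod_eq_one fun i _ => hfactor i]
  rw [X_pow_dvd_iff]
  intro m hm
  have hlim := (continuous_coeff ℚ m).tendsto _ |>.comp
    (((Nat.Partition.hasProd_powerSeriesMk_card_restricted ℚ p).tendsto_prod_nat.mul_const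
      (∏ i ∈ range M, if p (i + 1) then 1 - X ^ (i + 1) else 1)).sub_const 1)
  refine tendsto_nhds_unique hlim (tendsto_const_nhds.congr' ?_)
  filter_upwards [Filter.eventually_ge_atTop M] with N hN
  exact (X_pow_dvd_iff.mp (hprod N hN) m hm).symm

theorem isInvQFactorial_X_pow {d : ℕ} (hd : d ≠ 0) : IsInvQFactorial (X ^ d : ℚ⟦X⟧)
    fun k => (∏ i ∈ range k, (1 - (X ^ d) ^ (i + 1)))⁻¹ := by
  have hconst (k : ℕ) : constantCoeff (∏ i ∈ range k, (1 - (X ^ d : ℚ⟦X⟧) ^ (i + 1))) ≠ 0 := by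
    rw [map_prod]
    simp [hd]
  refine ⟨by simp, fun k => ?_, fun k hk => ?_⟩
  · rw [PowerSeries.eq_inv_iff_mul_eq_one (hconst k), mul_right_comm, mul_comm (1 - _),
      ← prod_range_succ, PowerSeries.mul_inv_cancel _ (hconst (k + 1))]
  · simpa [hd] using congrArg constantCoeff hk

end Restricted

section Main

open PowerSeries

theorem card_evenOdd_eq_card {e : ℕ → ℚ⟦X⟧} {n r ε : ℕ} (p : ℕ → Prop)
    (hr : ∀ m, ∑ x ∈ antidiagonal m, X ^ (2 * m * x.1) * (evenGenFun x.1 * gapGenFun r x.2) =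
      X ^ (m * (m + ε)) * e m)
    (hp : ∀ f : ℕ → ℚ⟦X⟧, (∀ i, p (i + 1) → f i = 1 - X ^ (i + 1)) →
      (∀ i, ¬ p (i + 1) → f i = 1) →
      Ideal.Quotient.mk (Ideal.span {X ^ (n + 1)}) (∑ j ∈ range (n + 1), X ^ (j * (j + ε)) * e j) *
        Ideal.Quotient.mk (Ideal.span {X ^ (n + 1)}) (∏ i ∈ range (5 * (2 * n)), f i) = 1) :
    Nat.card {s : n.Partition // Multiset.count 1 s.parts ≤ r ∧
      (∀ x ∈ s.parts, Even x → 2 * Multiset.card s.parts ≤ x) ∧ GapCond s.oddParts 2 4} =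
    Nat.card {s : n.Partition // ∀ x ∈ s.parts, p x} := by
  classical
  set π := Ideal.Quotient.mk (Ideal.span {(X : ℚ⟦X⟧) ^ (n + 1)})
  set F := ∏ i ∈ range (5 * (2 * n)), if p (i + 1) then (1 - X ^ (i + 1) : ℚ⟦X⟧) else 1
  have h₁ := hp (fun i => if p (i + 1) then 1 - X ^ (i + 1) else 1) (fun i hi => if_pos hi)
    fun i hi => if_neg hi
  have h₂ : π (PowerSeries.mk fun k => (#(Nat.Partition.restricted k p) : ℚ)) * π F = 1 := by
    rw [← map_mul, ← map_one π, Ideal.Quotient.eq, Ideal.mem_span_singleton]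
    exact X_pow_dvd_restricted_mul_prod_sub_one p (by omega)
  have h₃ := (IsUnit.of_mul_eq_one_right _ h₁).mul_right_cancel (h₁.trans h₂.symm)
  rw [Ideal.Quotient.eq, Ideal.mem_span_singleton, X_pow_dvd_iff] at h₃
  have h₄ := h₃ n n.lt_succ_self
  rw [map_sub, sub_eq_zero, coeff_mk, map_sum] at h₄
  rw [card_partition_eq_sum, Nat.card_eq_fintype_card, Fintype.card_subtype]
  refine Nat.cast_injective (R := ℚ) (Eq.trans ?_ h₄)
  rw [Nat.cast_sum]
  refine sum_congr rfl fun m _ => ?_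
  rw [← hr, ← genFun_evenOddSet, genFun, coeff_mk]

theorem natCast_five_mul_add (i k : ℕ) : ((5 * i + k : ℕ) : ZMod 5) = (k : ZMod 5) := by
  have : (5 : ZMod 5) = 0 := by decide
  push_cast
  rw [this, zero_mul, zero_add]

end Main

end RogersRamanujan

/-- For every `n ≥ 0` and `i = 1` or `2`, the number of partitions of `n` with at
most `i - 1` parts equal to `1`, every even part at least twice the number of
parts, and odd parts (in decreasing order) satisfying
`λ_{j_ℓ} - λ_{j_{ℓ+2}} ≥ 4`, equals the number of partitions of `n` all of
whose parts are `≢ 0, ±i (mod 5)`. -/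
theorem evenOdd_rogersRamanujan_P_eq_A (n i : ℕ) (hi : i = 1 ∨ i = 2) :
    Nat.card {p : n.Partition //
      Multiset.count 1 p.parts ≤ i - 1 ∧
      (∀ x ∈ p.parts, Even x → 2 * Multiset.card p.parts ≤ x) ∧
      GapCond p.oddParts 2 4} =
    Nat.card {p : n.Partition //
      ∀ x ∈ p.parts,
        (x : ZMod 5) ≠ 0 ∧ (x : ZMod 5) ≠ (i : ZMod 5) ∧
        (x : ZMod 5) ≠ -(i : ZMod 5)} := by
  obtain ⟨e, he⟩ : ∃ e, RogersRamanujan.IsInvQFactorial (PowerSeries.X : PowerSeries ℚ) e := by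
    have h := RogersRamanujan.isInvQFactorial_X_pow one_ne_zero
    rw [pow_one] at h
    exact ⟨_, h⟩
  have he' := RogersRamanujan.isInvQFactorial_X_pow (d := 5) (by norm_num)
  have hπ : Ideal.Quotient.mk (Ideal.span {PowerSeries.X ^ (n + 1)})
      (PowerSeries.X ^ (n + 1) : PowerSeries ℚ) = 0 :=
    Ideal.Quotient.eq_zero_iff_mem.mpr (Ideal.mem_span_singleton_self _)
  rcases hi with rfl | rfl
  · refine RogersRamanujan.card_evenOdd_eq_card _ (fun m => (he.sum_gapGenFun m).2)
      fun f hf hf' => ?_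
    rw [← RogersRamanujan.map_second_rogersRamanujan he he' PowerSeries.X_ne_zero _ hπ le_rfl,
      RogersRamanujan.prod_range_five_mul]
    congr 2
    refine Finset.prod_congr rfl fun i _ => ?_
    rw [hf' (5 * i), hf (5 * i + 1), hf (5 * i + 2), hf' (5 * i + 3), hf' (5 * i + 4), one_mul,
      mul_one, mul_one]
    all_goals
      simp only [add_assoc, Nat.reduceAdd, RogersRamanujan.natCast_five_mul_add]
      decide
  · refine RogersRamanujan.card_evenOdd_eq_card _ (fun m => (he.sum_gapGenFun m).1)
      fun f hf hf' => ?_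
    rw [← RogersRamanujan.map_first_rogersRamanujan he he' PowerSeries.X_ne_zero _ hπ le_rfl,
      RogersRamanujan.prod_range_five_mul]
    congr 2
    refine Finset.prod_congr rfl fun i _ => ?_
    rw [hf (5 * i), hf' (5 * i + 1), hf' (5 * i + 2), hf (5 * i + 3), hf' (5 * i + 4), mul_one,
      mul_one, mul_one]
    all_goals
      simp only [add_assoc, Nat.reduceAdd, RogersRamanujan.natCast_five_mul_add]
      decide
end

section
/- For all nonnegative integers m and n and for i = 1 or i = 2, p_{2,i}(m,n) = b_{2,i}(m,n); that is, the number of partitions of n with exactly m parts, at most i-1 parts equal to 1, every even part at least 2m, and odd parts (in decreasing order) satisfying λ_{j_ℓ} - λ_{j_{ℓ+2}} ≥ 4 for all valid ℓ, equals the number of partitions of n with exactly m parts, any two parts differing by at least 2, and at most i-1 parts equal to 1. -/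
/-- `p2 i m n` = number of partitions of `n` with exactly `m` parts, at most
`i - 1` parts equal to `1`, every even part at least `2m`, and odd parts (in
decreasing order) satisfying `λ_{j_ℓ} - λ_{j_{ℓ+2}} ≥ 4`. -/
noncomputable def p2 (i m n : ℕ) : ℕ :=
  Nat.card {p : n.Partition //
    Multiset.card p.parts = m ∧
    Multiset.count 1 p.parts ≤ i - 1 ∧
    (∀ x ∈ p.parts, Even x → 2 * m ≤ x) ∧
    GapCond p.oddParts 2 4}

/-- `b2 i m n` = number of partitions of `n` with exactly `m` parts, any two
parts differing by at least `2`, and at most `i - 1` parts equal to `1`. -/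
noncomputable def b2 (i m n : ℕ) : ℕ :=
  Nat.card {p : n.Partition //
    Multiset.card p.parts = m ∧
    GapCond p.sortedParts 1 2 ∧
    Multiset.count 1 p.parts ≤ i - 1}

open PowerSeries

theorem gapCond_iff_countP_le {L : List ℕ} (hL : L.Pairwise (· ≤ ·)) {d g : ℕ} (hg : 0 < g) :
    GapCond L d g ↔ ∀ x, L.countP (fun y => x ≤ y ∧ y < x + g) ≤ d := by
  have mono : ∀ a b (_ : a ≤ b) (hb : b < L.length), L[a] ≤ L[b] := fun a b hab hb =>
    hL.sortedLE.getElem_le_getElem_of_le hab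
  constructor
  · intro h x
    by_contra! hc
    rw [List.countP_eq_length_filter] at hc
    obtain ⟨f, hf⟩ := List.sublist_iff_exists_fin_orderEmbedding_get_eq.1
      (List.filter_sublist (l := L) (p := fun y => decide (x ≤ y ∧ y < x + g)))
    have hmem : ∀ k, x ≤ L.get (f k) ∧ L.get (f k) < x + g := fun k => by
      rw [← hf k]
      simpa using List.of_mem_filter (List.get_mem _ k)
    have hstep : ∀ k (hk : k < (L.filter fun y => decide (x ≤ y ∧ y < x + g)).length),
        (f ⟨0, by omega⟩ : ℕ) + k ≤ f ⟨k, hk⟩ := by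
      intro k
      induction k with
      | zero => intro hk; simp
      | succ k ih =>
        intro hk
        have h1 := ih (by omega)
        have h2 : f ⟨k, by omega⟩ < f ⟨k + 1, hk⟩ := f.strictMono (by simp)
        have h3 : (f ⟨k, by omega⟩ : ℕ) < f ⟨k + 1, hk⟩ := h2
        omega
    have h1 := hstep d hc
    have h2 := (f ⟨d, hc⟩).2
    have h3 := h (f ⟨0, by omega⟩) (by omega)
    rw [getElem!_pos L _ (by omega), getElem!_pos L _ (by omega)] at h3
    have h4 := mono _ _ h1 h2
    have h5 := (hmem ⟨0, by omega⟩).1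
    have h6 := (hmem ⟨d, hc⟩).2
    simp only [List.get_eq_getElem] at h5 h6
    omega
  · intro h l hl
    rw [getElem!_pos L _ hl, getElem!_pos L _ (by omega)]
    by_contra! hc
    have hsub : ((L.drop l).take (d + 1)).Sublist L :=
      (List.take_sublist _ _).trans (List.drop_sublist _ _)
    have h1 := (hsub.countP_le (p := fun y => decide (L[l] ≤ y ∧ y < L[l] + g))).trans (h L[l])
    rw [List.countP_eq_length.2] at h1
    · simp at h1; omega
    · intro y hy
      obtain ⟨k, hk, rfl⟩ := List.mem_iff_getElem.1 hy
      simp only [List.length_take, List.length_drop] at hk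
      simp only [List.getElem_take, List.getElem_drop, decide_eq_true_eq]
      have h2 := mono l (l + k) (by omega) (by omega)
      have h3 := mono (l + k) (l + d) (by omega) hl
      omega

theorem gapCond_sort_iff {s : Multiset ℕ} {d g : ℕ} (hg : 0 < g) :
    GapCond (s.sort (· ≤ ·)) d g ↔ ∀ x, s.countP (fun y => x ≤ y ∧ y < x + g) ≤ d := by
  rw [gapCond_iff_countP_le (Multiset.pairwise_sort s (· ≤ ·)) hg]
  conv_rhs => rw [← Multiset.sort_eq s (· ≤ ·)]
  simp only [Multiset.coe_countP]

theorem Multiset.countP_eq_or_eq (s : Multiset ℕ) {a b : ℕ} (h : a ≠ b) :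
    s.countP (fun y => y = a ∨ y = b) = s.count a + s.count b := by
  induction s using Multiset.induction_on with
  | empty => simp
  | cons c s ih =>
    simp only [Multiset.countP_cons, Multiset.count_cons, ih]
    split_ifs <;> omega

theorem gapCond_sort_one_two_iff {s : Multiset ℕ} :
    GapCond (s.sort (· ≤ ·)) 1 2 ↔ ∀ x, s.count x + s.count (x + 1) ≤ 1 := by
  rw [gapCond_sort_iff two_pos]
  refine forall_congr' fun x => ?_
  rw [← s.countP_eq_or_eq (by omega)]
  have : ∀ y, (x ≤ y ∧ y < x + 2) ↔ (y = x ∨ y = x + 1) := by omega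
  simp only [this]

theorem gapCond_sort_odd_two_four_iff {s : Multiset ℕ} :
    GapCond ((s.filter fun x => ¬ Even x).sort (· ≤ ·)) 2 4 ↔
      ∀ x, Odd x → s.count x + s.count (x + 2) ≤ 2 := by
  rw [gapCond_sort_iff four_pos]
  have key : ∀ x, Odd x → ∀ y, ((x ≤ y ∧ y < x + 4) ∧ ¬ Even y) ↔ (y = x ∨ y = x + 2) := by
    intro x hx y
    rw [Nat.even_iff]
    rw [Nat.odd_iff] at hx
    omega
  have hodd : ∀ x, Odd x → (s.filter fun x => ¬ Even x).countP (fun y => x ≤ y ∧ y < x + 4) =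
      s.count x + s.count (x + 2) := by
    intro x hx
    rw [Multiset.countP_filter, ← s.countP_eq_or_eq (by omega)]
    simp only [key x hx]
  constructor
  · intro h x hx
    rw [← hodd x hx]
    exact h x
  · intro h x
    rcases Nat.even_or_odd x with hx | hx
    · have hx' := hx.add_one
      refine le_trans ?_ ((hodd _ hx').trans_le (h _ hx'))
      rw [Multiset.countP_filter, Multiset.countP_filter,
        Multiset.countP_eq_card_filter, Multiset.countP_eq_card_filter]
      refine Multiset.card_le_card (Multiset.monotone_filter_right s fun y hy => ?_)
      rw [Nat.even_iff] at *
      omega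
    · exact (hodd x hx).trans_le (h x hx)

/-- The generating function of a set of multisets of natural numbers, by sum. -/
noncomputable def sumGenFun (S : Set (Multiset ℕ)) : ℤ⟦X⟧ :=
  PowerSeries.mk fun n => ((S ∩ {s | s.sum = n}).ncard : ℤ)

theorem finite_setOf_card_sum (m n : ℕ) : {s : Multiset ℕ | s.card = m ∧ s.sum = n}.Finite := by
  refine (Set.finite_range fun t : Sym (Fin (n + 1)) m => t.1.map Fin.val).subset ?_
  rintro s ⟨hm, hn⟩
  refine ⟨⟨s.map (Fin.ofNat (n + 1)), by simpa using hm⟩, ?_⟩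
  simp only [Multiset.map_map]
  conv_rhs => rw [← Multiset.map_id s]
  refine Multiset.map_congr rfl fun x hx => ?_
  have := Multiset.le_sum_of_mem hx
  simp only [Function.comp, Fin.val_ofNat, id]
  exact Nat.mod_eq_of_lt (by omega)

theorem sumGenFun_union {S T : Set (Multiset ℕ)} (m : ℕ) (hS : ∀ s ∈ S, s.card = m)
    (hT : ∀ s ∈ T, s.card = m) (hd : Disjoint S T) :
    sumGenFun (S ∪ T) = sumGenFun S + sumGenFun T := by
  ext n
  simp only [sumGenFun, PowerSeries.coeff_mk, map_add]
  have hfin : ∀ U : Set (Multiset ℕ), (∀ s ∈ U, s.card = m) → (U ∩ {s | s.sum = n}).Finite :=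
    fun U hU => (finite_setOf_card_sum m n).subset fun s hs => ⟨hU s hs.1, hs.2⟩
  rw [Set.union_inter_distrib_right, Set.ncard_union_eq
    (hd.mono Set.inter_subset_left Set.inter_subset_left) (hfin S hS) (hfin T hT)]
  push_cast
  rfl

theorem sumGenFun_image {S : Set (Multiset ℕ)} {f : Multiset ℕ → Multiset ℕ} (k : ℕ)
    (hf : Function.Injective f) (hk : ∀ s ∈ S, (f s).sum = s.sum + k) :
    sumGenFun (f '' S) = X ^ k * sumGenFun S := by
  ext n
  simp only [sumGenFun, PowerSeries.coeff_mk, PowerSeries.coeff_X_pow_mul']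
  have key : f '' S ∩ {s | s.sum = n} = f '' (S ∩ {s | s.sum + k = n}) := by
    ext s
    constructor
    · rintro ⟨⟨t, ht, rfl⟩, hs⟩
      exact ⟨t, ⟨ht, (hk t ht).symm.trans hs⟩, rfl⟩
    · rintro ⟨t, ⟨ht, hs⟩, rfl⟩
      exact ⟨⟨t, ht, rfl⟩, (hk t ht).trans hs⟩
  rw [key, Set.ncard_image_of_injective _ hf]
  split_ifs with h
  · have : ∀ s : Multiset ℕ, s.sum + k = n ↔ s.sum = n - k := by omega
    simp only [this]
  · have : ∀ s : Multiset ℕ, ¬ s.sum + k = n := by omega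
    simp [this]

theorem Multiset.map_add_right_injective (k : ℕ) :
    Function.Injective (Multiset.map (· + k) : Multiset ℕ → Multiset ℕ) :=
  Multiset.map_injective (add_left_injective k)

theorem Multiset.sum_map_add_right (s : Multiset ℕ) (k : ℕ) :
    (s.map (· + k)).sum = s.sum + s.card * k := by
  simp [Multiset.sum_map_add]

theorem Multiset.exists_map_add_right_eq {s : Multiset ℕ} {k : ℕ} (h : ∀ x ∈ s, k ≤ x) :
    ∃ t : Multiset ℕ, t.map (· + k) = s := by
  refine ⟨s.map (· - k), ?_⟩
  rw [Multiset.map_map]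
  conv_rhs => rw [← Multiset.map_id s]
  exact Multiset.map_congr rfl fun x hx => Nat.sub_add_cancel (h x hx)

theorem Multiset.count_map_add_right (s : Multiset ℕ) (k x : ℕ) :
    (s.map (· + k)).count (x + k) = s.count x :=
  Multiset.count_map_eq_count' (· + k) s (add_left_injective k) x

theorem Multiset.count_map_add_right_of_lt (s : Multiset ℕ) {k x : ℕ} (h : x < k) :
    (s.map (· + k)).count x = 0 := by
  rw [Multiset.count_eq_zero, Multiset.mem_map]
  rintro ⟨y, -, hy⟩
  omega

/-- Multisets of `m` naturals with at most `i` ones, even entries at least `c`, and at most two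
entries in each pair `{x, x + 2}` of consecutive odd numbers. -/
def oddGapSet (i c m : ℕ) : Set (Multiset ℕ) :=
  {s | s.card = m ∧ s.count 1 ≤ i ∧ (∀ x ∈ s, Even x → c ≤ x) ∧
    ∀ x, Odd x → s.count x + s.count (x + 2) ≤ 2}

/-- Multisets of `m` positive naturals with at most `i` ones, any two entries of which differ by at
least two. -/
def gapTwoSet (i m : ℕ) : Set (Multiset ℕ) :=
  {s | s.card = m ∧ 0 ∉ s ∧ s.count 1 ≤ i ∧ ∀ x, s.count x + s.count (x + 1) ≤ 1}

theorem oddGapSet_zero (i c : ℕ) : oddGapSet i c 0 = {0} := by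
  ext s
  simp only [oddGapSet, Set.mem_ofPred_eq, Set.mem_singleton_iff, Multiset.card_eq_zero]
  constructor
  · exact fun h => h.1
  · rintro rfl
    simp

theorem gapTwoSet_zero (i : ℕ) : gapTwoSet i 0 = {0} := by
  ext s
  simp only [gapTwoSet, Set.mem_ofPred_eq, Set.mem_singleton_iff, Multiset.card_eq_zero]
  constructor
  · exact fun h => h.1
  · rintro rfl
    simp

theorem map_add_two_mem_oddGapSet {c m : ℕ} {t : Multiset ℕ} :
    t.map (· + 2) ∈ oddGapSet 0 (c + 2) m ↔ t ∈ oddGapSet 2 c m := by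
  simp only [oddGapSet, Set.mem_ofPred_eq, Multiset.card_map, Multiset.mem_map,
    forall_exists_index, and_imp, forall_apply_eq_imp_iff₂,
    (by simp [parity_simps] : ∀ x : ℕ, Even (x + 2) ↔ Even x)]
  refine and_congr_right fun _ => ?_
  have h1 := t.count_map_add_right_of_lt one_lt_two
  constructor
  · rintro ⟨-, he, ho⟩
    refine ⟨?_, fun x hx hx' => by have := he x hx hx'; omega, fun x hx => ?_⟩
    · have := ho 1 odd_one
      rw [h1, Multiset.count_map_add_right] at this
      omega
    · have := ho (x + 2) (by simpa [parity_simps] using hx)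
      rwa [Multiset.count_map_add_right, Multiset.count_map_add_right] at this
  · rintro ⟨h, he, ho⟩
    refine ⟨h1.le, fun x hx hx' => by have := he x hx hx'; omega, fun x hx => ?_⟩
    rw [Multiset.count_map_add_right]
    rcases lt_or_ge x 2 with hx2 | hx2
    · obtain rfl : x = 1 := by rw [Nat.odd_iff] at hx; omega
      omega
    · obtain ⟨y, rfl⟩ := Nat.exists_eq_add_of_le' hx2
      rw [Multiset.count_map_add_right]
      exact ho y (by simpa [parity_simps] using hx)

theorem oddGapSet_no_ones (c m : ℕ) :
    oddGapSet 0 (c + 2) m = Multiset.map (· + 2) '' oddGapSet 2 c m := by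
  ext s
  constructor
  · intro hs
    obtain ⟨t, rfl⟩ := Multiset.exists_map_add_right_eq (s := s) (k := 2) fun x hx => by
      have h1 : x ≠ 1 := by
        rintro rfl
        exact Multiset.count_eq_zero.1 (Nat.le_zero.1 hs.2.1) hx
      have h0 : x ≠ 0 := by
        rintro rfl
        exact absurd (hs.2.2.1 0 hx Even.zero) (by omega)
      omega
    exact ⟨t, map_add_two_mem_oddGapSet.1 hs, rfl⟩
  · rintro ⟨t, ht, rfl⟩
    exact map_add_two_mem_oddGapSet.2 ht

theorem oddGapSet_succ (i c m : ℕ) (hc : Even c) :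
    oddGapSet i c (m + 1) = oddGapSet i (c + 2) (m + 1) ∪ Multiset.cons c '' oddGapSet i c m := by
  have hcount : ∀ (t : Multiset ℕ) x, Odd x → (c ::ₘ t).count x = t.count x := fun t x hx =>
    Multiset.count_cons_of_ne (by rintro rfl; exact Nat.not_odd_iff_even.2 hc hx) t
  have hcons : ∀ t, c ::ₘ t ∈ oddGapSet i c (m + 1) ↔ t ∈ oddGapSet i c m := by
    intro t
    simp only [oddGapSet, Set.mem_ofPred_eq, Multiset.card_cons, Nat.add_right_cancel_iff,
      Multiset.mem_cons, forall_eq_or_imp, le_refl, implies_true, true_and, hcount t 1 odd_one]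
    refine and_congr_right fun _ => and_congr_right fun _ => and_congr_right fun _ =>
      forall₂_congr fun x hx => ?_
    rw [hcount t x hx, hcount t (x + 2) (by simpa [parity_simps] using hx)]
  ext s
  constructor
  · intro hs
    by_cases h : c ∈ s
    · obtain ⟨t, rfl⟩ := Multiset.exists_cons_of_mem h
      exact Or.inr ⟨t, (hcons t).1 hs, rfl⟩
    · refine Or.inl ⟨hs.1, hs.2.1, fun x hx hxe => ?_, hs.2.2.2⟩
      have h1 := hs.2.2.1 x hx hxe
      have h2 : x ≠ c := by rintro rfl; exact h hx
      rw [Nat.even_iff] at hc hxe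
      omega
  · rintro (hs | ⟨t, ht, rfl⟩)
    · exact ⟨hs.1, hs.2.1, fun x hx hxe => by have := hs.2.2.1 x hx hxe; omega, hs.2.2.2⟩
    · exact (hcons t).2 ht

theorem oddGapSet_one_succ (c m : ℕ) :
    oddGapSet 1 (c + 2) (m + 1) = oddGapSet 0 (c + 2) (m + 1) ∪
      (fun t => 1 ::ₘ t.map (· + 2)) '' oddGapSet 1 c m := by
  ext s
  constructor
  · intro hs
    by_cases h : 1 ∈ s
    · obtain ⟨t, rfl⟩ := Multiset.exists_cons_of_mem h
      obtain ⟨hm, h1, he, ho⟩ := hs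
      have ht : t ∈ oddGapSet 0 (c + 2) m := by
        refine ⟨by simpa using hm, by simpa using h1,
          fun x hx => he x (Multiset.mem_cons_of_mem hx), fun x hx => le_trans ?_ (ho x hx)⟩
        exact add_le_add (Multiset.count_le_count_cons _ _ _) (Multiset.count_le_count_cons _ _ _)
      rw [oddGapSet_no_ones] at ht
      obtain ⟨u, hu, rfl⟩ := ht
      refine Or.inr ⟨u, ⟨hu.1, ?_, hu.2.2⟩, rfl⟩
      have := ho 1 odd_one
      rw [Multiset.count_cons_self, Multiset.count_cons_of_ne (by norm_num),
        Multiset.count_map_add_right] at this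
      omega
    · exact Or.inl ⟨hs.1, (Multiset.count_eq_zero.2 h).le, hs.2.2⟩
  · rintro (hs | ⟨t, ht, rfl⟩)
    · exact ⟨hs.1, hs.2.1.trans zero_le_one, hs.2.2⟩
    · obtain ⟨hm, h1, he, ho⟩ :=
        map_add_two_mem_oddGapSet.2 (⟨ht.1, ht.2.1.trans one_le_two, ht.2.2⟩ : t ∈ oddGapSet 2 c m)
      refine ⟨by simpa using hm, by simp, ?_, fun x hx => ?_⟩
      · intro x hx hxe
        rcases Multiset.mem_cons.1 hx with rfl | hx
        · exact absurd hxe Nat.not_even_one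
        · exact he x hx hxe
      · have h := ho x hx
        have h2 := ht.2.1
        rw [Multiset.count_cons_of_ne (a := x + 2) (by omega), Multiset.count_map_add_right] at *
        by_cases hx1 : x = 1
        · subst hx1
          rw [Multiset.count_cons_self]
          omega
        · rwa [Multiset.count_cons_of_ne hx1]

theorem oddGapSet_two_add_two (c m : ℕ) :
    oddGapSet 2 (c + 4) (m + 2) = oddGapSet 1 (c + 4) (m + 2) ∪
      (fun t => 1 ::ₘ 1 ::ₘ t.map (· + 4)) '' oddGapSet 2 c m := by
  have hmap : ∀ t : Multiset ℕ, t.map (· + 4) = (t.map (· + 2)).map (· + 2) := by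
    intro t
    rw [Multiset.map_map]
    rfl
  ext s
  constructor
  · intro hs
    by_cases h : s.count 1 ≤ 1
    · exact Or.inl ⟨hs.1, h, hs.2.2⟩
    · obtain ⟨t, rfl⟩ := Multiset.exists_cons_of_mem
        (Multiset.count_pos.1 (by omega : 0 < s.count 1))
      rw [Multiset.count_cons_self] at h
      obtain ⟨t, rfl⟩ := Multiset.exists_cons_of_mem
        (Multiset.count_pos.1 (by omega : 0 < t.count 1))
      obtain ⟨hm, h1, he, ho⟩ := hs
      have ht : t ∈ oddGapSet 0 (c + 2 + 2) m := by
        refine ⟨by simpa using hm, by simpa using h1,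
          fun x hx => he x (Multiset.mem_cons_of_mem (Multiset.mem_cons_of_mem hx)),
          fun x hx => le_trans ?_ (ho x hx)⟩
        exact add_le_add
          ((Multiset.count_le_count_cons _ _ _).trans (Multiset.count_le_count_cons _ _ _))
          ((Multiset.count_le_count_cons _ _ _).trans (Multiset.count_le_count_cons _ _ _))
      rw [oddGapSet_no_ones] at ht
      obtain ⟨u, hu, rfl⟩ := ht
      have hu' : u ∈ oddGapSet 0 (c + 2) m := by
        refine ⟨hu.1, ?_, hu.2.2⟩
        have := ho 1 odd_one
        simp only [Multiset.count_cons_self, ne_eq, Nat.reduceAdd, Nat.reduceEqDiff,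
          not_false_eq_true, Multiset.count_cons_of_ne] at this
        rw [u.count_map_add_right 2 1] at this
        omega
      rw [oddGapSet_no_ones] at hu'
      obtain ⟨v, hv, rfl⟩ := hu'
      exact Or.inr ⟨v, hv, by simp only [hmap]⟩
  · rintro (hs | ⟨t, ht, rfl⟩)
    · exact ⟨hs.1, hs.2.1.trans one_le_two, hs.2.2⟩
    · have ht1 := map_add_two_mem_oddGapSet.2 ht
      obtain ⟨hm, h1, he, ho⟩ := map_add_two_mem_oddGapSet.2
        (⟨ht1.1, ht1.2.1.trans zero_le_two, ht1.2.2⟩ : t.map (· + 2) ∈ oddGapSet 2 (c + 2) m)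
      rw [← hmap] at *
      refine ⟨by simpa using hm, by simp, ?_, fun x hx => ?_⟩
      · intro x hx hxe
        rcases Multiset.mem_cons.1 hx with rfl | hx
        · exact absurd hxe Nat.not_even_one
        rcases Multiset.mem_cons.1 hx with rfl | hx
        · exact absurd hxe Nat.not_even_one
        · exact he x hx hxe
      · have h := ho x hx
        rw [Multiset.count_cons_of_ne (a := x + 2) (by omega),
          Multiset.count_cons_of_ne (a := x + 2) (by omega)]
        by_cases hx1 : x = 1
        · subst hx1
          rw [Multiset.count_cons_self, Multiset.count_cons_self,
            Multiset.count_map_add_right_of_lt _ (by omega),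
            Multiset.count_map_add_right_of_lt _ (by omega)]
        · rwa [Multiset.count_cons_of_ne hx1, Multiset.count_cons_of_ne hx1]

theorem oddGapSet_two_one (c : ℕ) : oddGapSet 2 c 1 = oddGapSet 1 c 1 := by
  ext s
  have := Multiset.count_le_card 1 s
  simp only [oddGapSet, Set.mem_ofPred_eq]
  refine and_congr_right fun h => and_congr_left fun _ => ?_
  omega

theorem map_succ_mem_gapTwoSet {m : ℕ} {t : Multiset ℕ} (h0 : 0 ∉ t) :
    t.map (· + 1) ∈ gapTwoSet 0 m ↔ t ∈ gapTwoSet 1 m := by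
  have hc0 := Multiset.count_eq_zero.2 h0
  have h1 : (t.map (· + 1)).count 1 = 0 := by rw [t.count_map_add_right 1 0, hc0]
  simp only [gapTwoSet, Set.mem_ofPred_eq, Multiset.card_map, h0, not_false_eq_true, true_and, h1,
    le_refl, ← Multiset.count_eq_zero (s := t.map (· + 1)),
    Multiset.count_map_add_right_of_lt t one_pos]
  refine and_congr_right fun _ => ?_
  constructor
  · intro h
    have h' : ∀ x, t.count x + t.count (x + 1) ≤ 1 := fun x => by
      have := h (x + 1)
      rwa [Multiset.count_map_add_right, Multiset.count_map_add_right] at this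
    exact ⟨(Nat.le_add_left _ _).trans (h' 0), h'⟩
  · rintro ⟨-, h⟩ x
    cases x with
    | zero => rw [Multiset.count_map_add_right_of_lt t one_pos, zero_add, zero_add, h1]; omega
    | succ x =>
      rw [Multiset.count_map_add_right, Multiset.count_map_add_right]
      exact h x

theorem gapTwoSet_no_ones (m : ℕ) :
    gapTwoSet 0 m = Multiset.map (· + 1) '' gapTwoSet 1 m := by
  ext s
  constructor
  · intro hs
    obtain ⟨t, rfl⟩ := Multiset.exists_map_add_right_eq (s := s) (k := 1) fun x hx =>
      Nat.one_le_iff_ne_zero.2 (by rintro rfl; exact hs.2.1 hx)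
    refine ⟨t, (map_succ_mem_gapTwoSet ?_).1 hs, rfl⟩
    rw [← Multiset.count_eq_zero, ← Multiset.count_map_add_right t 1 0]
    exact Nat.le_zero.1 hs.2.2.1
  · rintro ⟨t, ht, rfl⟩
    exact (map_succ_mem_gapTwoSet ht.2.1).2 ht

theorem gapTwoSet_one_succ (m : ℕ) :
    gapTwoSet 1 (m + 1) = gapTwoSet 0 (m + 1) ∪
      (fun t => 1 ::ₘ t.map (· + 2)) '' gapTwoSet 1 m := by
  ext s
  constructor
  · intro hs
    by_cases h : 1 ∈ s
    · obtain ⟨t, rfl⟩ := Multiset.exists_cons_of_mem h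
      obtain ⟨hm, h0, h1, hg⟩ := hs
      have hg' : ∀ x, t.count x + t.count (x + 1) ≤ 1 := fun x =>
        (add_le_add (Multiset.count_le_count_cons _ _ _)
          (Multiset.count_le_count_cons _ _ _)).trans (hg x)
      have h12 := hg 1
      rw [Multiset.count_cons_self, Multiset.count_cons_of_ne (by norm_num)] at h12
      obtain ⟨u, rfl⟩ := Multiset.exists_map_add_right_eq (s := t) (k := 2) fun x hx => by
        have hx0 : x ≠ 0 := by rintro rfl; exact h0 (Multiset.mem_cons_of_mem hx)
        have hx1 : x ≠ 1 := by
          rintro rfl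
          have := Multiset.count_pos.2 hx
          omega
        omega
      have hu : ∀ x, u.count x + u.count (x + 1) ≤ 1 := fun x => by
        have := hg' (x + 2)
        rwa [u.count_map_add_right 2 x, u.count_map_add_right 2 (x + 1)] at this
      refine Or.inr ⟨u, ⟨by simpa using hm, ?_, ?_, hu⟩, rfl⟩
      · rw [← Multiset.count_eq_zero, ← u.count_map_add_right 2 0]
        simp only [Nat.reduceAdd, zero_add] at h12 ⊢
        omega
      · have := hu 0
        simp only [zero_add] at this
        omega
    · exact Or.inl ⟨hs.1, hs.2.1, (Multiset.count_eq_zero.2 h).le, hs.2.2.2⟩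
  · rintro (hs | ⟨t, ⟨hm, h0, h1, hg⟩, rfl⟩)
    · exact ⟨hs.1, hs.2.1, hs.2.2.1.trans zero_le_one, hs.2.2.2⟩
    · have c1 := t.count_map_add_right_of_lt (k := 2) (x := 1) (by omega)
      have c2 : (t.map (· + 2)).count 2 = 0 := by
        rw [t.count_map_add_right 2 0]
        exact Multiset.count_eq_zero.2 h0
      refine ⟨by simpa using hm, by simp, by rw [Multiset.count_cons_self, c1], fun x => ?_⟩
      rcases x with _ | _ | x
      · simp
      · simp [c2]
      · rw [Multiset.count_cons_of_ne (by omega), Multiset.count_cons_of_ne (by omega),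
          t.count_map_add_right 2 x, t.count_map_add_right 2 (x + 1)]
        exact hg x

theorem sumGenFun_oddGapSet_no_ones (c m : ℕ) :
    sumGenFun (oddGapSet 0 (c + 2) m) = X ^ (2 * m) * sumGenFun (oddGapSet 2 c m) := by
  rw [oddGapSet_no_ones]
  refine sumGenFun_image _ (Multiset.map_add_right_injective 2) fun s hs => ?_
  rw [Multiset.sum_map_add_right, hs.1, mul_comm]

theorem sumGenFun_oddGapSet_succ (i c m : ℕ) (hc : Even c) :
    sumGenFun (oddGapSet i c (m + 1)) =
      sumGenFun (oddGapSet i (c + 2) (m + 1)) + X ^ c * sumGenFun (oddGapSet i c m) := by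
  rw [oddGapSet_succ i c m hc, sumGenFun_union (m + 1) (fun s hs => hs.1)]
  · congr 1
    exact sumGenFun_image c (fun s t => (Multiset.cons_inj_right c).1) fun s _ => by
      rw [Multiset.sum_cons, add_comm]
  · rintro _ ⟨t, ht, rfl⟩
    rw [Multiset.card_cons, ht.1]
  · rw [Set.disjoint_right]
    rintro _ ⟨t, -, rfl⟩ h
    have := h.2.2.1 c (Multiset.mem_cons_self c t) hc
    omega

theorem sumGenFun_oddGapSet_one_succ (c m : ℕ) :
    sumGenFun (oddGapSet 1 (c + 2) (m + 1)) =
      sumGenFun (oddGapSet 0 (c + 2) (m + 1)) + X ^ (2 * m + 1) * sumGenFun (oddGapSet 1 c m) := by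
  rw [oddGapSet_one_succ, sumGenFun_union (m + 1) (fun s hs => hs.1)]
  · congr 1
    refine sumGenFun_image _ (fun s t h => Multiset.map_add_right_injective 2
      ((Multiset.cons_inj_right 1).1 h)) fun s hs => ?_
    rw [Multiset.sum_cons, Multiset.sum_map_add_right, hs.1]
    ring
  · rintro _ ⟨t, ht, rfl⟩
    rw [Multiset.card_cons, Multiset.card_map, ht.1]
  · rw [Set.disjoint_right]
    rintro _ ⟨t, -, rfl⟩ h
    have := h.2.1
    rw [Multiset.count_cons_self] at this
    omega

theorem sumGenFun_oddGapSet_two_add_two (c m : ℕ) :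
    sumGenFun (oddGapSet 2 (c + 4) (m + 2)) =
      sumGenFun (oddGapSet 1 (c + 4) (m + 2)) + X ^ (4 * m + 2) * sumGenFun (oddGapSet 2 c m) := by
  rw [oddGapSet_two_add_two, sumGenFun_union (m + 2) (fun s hs => hs.1)]
  · congr 1
    refine sumGenFun_image _ (fun s t h => Multiset.map_add_right_injective 4
      ((Multiset.cons_inj_right 1).1 ((Multiset.cons_inj_right 1).1 h))) fun s hs => ?_
    rw [Multiset.sum_cons, Multiset.sum_cons, Multiset.sum_map_add_right, hs.1]
    ring
  · rintro _ ⟨t, ht, rfl⟩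
    rw [Multiset.card_cons, Multiset.card_cons, Multiset.card_map, ht.1]
  · rw [Set.disjoint_right]
    rintro _ ⟨t, -, rfl⟩ h
    have := h.2.1
    rw [Multiset.count_cons_self, Multiset.count_cons_self] at this
    omega

theorem sumGenFun_gapTwoSet_no_ones (m : ℕ) :
    sumGenFun (gapTwoSet 0 m) = X ^ m * sumGenFun (gapTwoSet 1 m) := by
  rw [gapTwoSet_no_ones]
  refine sumGenFun_image _ (Multiset.map_add_right_injective 1) fun s hs => ?_
  rw [Multiset.sum_map_add_right, hs.1, mul_one]

theorem sumGenFun_gapTwoSet_one_succ (m : ℕ) :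
    sumGenFun (gapTwoSet 1 (m + 1)) =
      sumGenFun (gapTwoSet 0 (m + 1)) + X ^ (2 * m + 1) * sumGenFun (gapTwoSet 1 m) := by
  rw [gapTwoSet_one_succ, sumGenFun_union (m + 1) (fun s hs => hs.1)]
  · congr 1
    refine sumGenFun_image _ (fun s t h => Multiset.map_add_right_injective 2
      ((Multiset.cons_inj_right 1).1 h)) fun s hs => ?_
    rw [Multiset.sum_cons, Multiset.sum_map_add_right, hs.1]
    ring
  · rintro _ ⟨t, ht, rfl⟩
    rw [Multiset.card_cons, Multiset.card_map, ht.1]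
  · rw [Set.disjoint_right]
    rintro _ ⟨t, -, rfl⟩ h
    have := h.2.2.1
    rw [Multiset.count_cons_self] at this
    omega

theorem sumGenFun_oddGapSet_no_ones_succ (m : ℕ) :
    sumGenFun (oddGapSet 0 (2 * (m + 1)) (m + 1)) =
      X ^ (2 * (m + 1)) * (sumGenFun (oddGapSet 2 (2 * (m + 1)) (m + 1)) +
        X ^ (2 * m) * sumGenFun (oddGapSet 2 (2 * m) m)) := by
  rw [mul_add 2 m 1, mul_one, sumGenFun_oddGapSet_no_ones,
    sumGenFun_oddGapSet_succ 2 _ _ (even_two_mul m)]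
  ring

theorem sumGenFun_oddGapSet_no_ones_succ' (m : ℕ) :
    sumGenFun (oddGapSet 0 (2 * (m + 1)) (m + 1)) =
      X ^ (2 * (m + 1)) * (sumGenFun (oddGapSet 1 (2 * (m + 1)) (m + 1)) +
        sumGenFun (oddGapSet 0 (2 * m) m)) := by
  rw [sumGenFun_oddGapSet_no_ones_succ]
  cases m with
  | zero => simp [oddGapSet_two_one, oddGapSet_zero]
  | succ m =>
    rw [sumGenFun_oddGapSet_no_ones_succ m,
      show 2 * (m + 1 + 1) = 2 * m + 4 by ring, sumGenFun_oddGapSet_two_add_two]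
    ring

theorem one_sub_X_pow_succ_ne_zero (m : ℕ) : (1 - X ^ (m + 1) : ℤ⟦X⟧) ≠ 0 := fun h => by
  simpa using congrArg PowerSeries.constantCoeff h

theorem one_add_X_pow_succ_ne_zero (m : ℕ) : (1 + X ^ (m + 1) : ℤ⟦X⟧) ≠ 0 := fun h => by
  simpa using congrArg PowerSeries.constantCoeff h

theorem sumGenFun_oddGapSet_zero_eq_X_pow_mul (m : ℕ) :
    sumGenFun (oddGapSet 0 (2 * m) m) = X ^ m * sumGenFun (oddGapSet 1 (2 * m) m) := by
  induction m with
  | zero => simp [oddGapSet_zero]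
  | succ m ih =>
    have h1 := sumGenFun_oddGapSet_no_ones_succ' m
    have h2 := sumGenFun_oddGapSet_one_succ (2 * m) m
    rw [show 2 * m + 2 = 2 * (m + 1) by ring] at h2
    rw [ih] at h1
    refine mul_left_cancel₀ (one_add_X_pow_succ_ne_zero m) ?_
    linear_combination h1 - X ^ (m + 1) * h2

theorem sumGenFun_oddGapSet_one_eq (m : ℕ) :
    sumGenFun (oddGapSet 1 (2 * m) m) = sumGenFun (gapTwoSet 1 m) := by
  induction m with
  | zero => rw [oddGapSet_zero, gapTwoSet_zero]
  | succ m ih =>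
    have h1 := sumGenFun_oddGapSet_one_succ (2 * m) m
    rw [show 2 * m + 2 = 2 * (m + 1) by ring, sumGenFun_oddGapSet_zero_eq_X_pow_mul, ih] at h1
    have h2 := sumGenFun_gapTwoSet_one_succ m
    rw [sumGenFun_gapTwoSet_no_ones] at h2
    refine mul_left_cancel₀ (one_sub_X_pow_succ_ne_zero m) ?_
    linear_combination h1 - h2

theorem sumGenFun_oddGapSet_eq {i : ℕ} (hi : i ≤ 1) (m : ℕ) :
    sumGenFun (oddGapSet i (2 * m) m) = sumGenFun (gapTwoSet i m) := by
  interval_cases i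
  · rw [sumGenFun_oddGapSet_zero_eq_X_pow_mul, sumGenFun_gapTwoSet_no_ones,
      sumGenFun_oddGapSet_one_eq]
  · exact sumGenFun_oddGapSet_one_eq m

theorem card_partition_eq_ncard {n : ℕ} {P : Multiset ℕ → Prop} {S : Set (Multiset ℕ)}
    (h : ∀ s, s ∈ S ↔ 0 ∉ s ∧ P s) :
    Nat.card {p : n.Partition // P p.parts} = (S ∩ {s | s.sum = n}).ncard := by
  rw [← Nat.card_coe_set_eq]
  refine Nat.card_congr
    { toFun := fun p => ⟨p.1.parts, (h _).2 ⟨fun h0 => (p.1.parts_pos h0).ne rfl, p.2⟩,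
        p.1.parts_sum⟩
      invFun := fun s => ⟨⟨s.1, fun {x} hx => Nat.pos_of_ne_zero (by
        rintro rfl; exact ((h _).1 s.2.1).1 hx), s.2.2⟩, ((h _).1 s.2.1).2⟩
      left_inv := fun p => rfl
      right_inv := fun s => rfl }

/-- For all `m, n ≥ 0` and `i = 1` or `2`, `p_{2,i}(m,n) = b_{2,i}(m,n)`. -/
theorem p2_eq_b2 (m n i : ℕ) (hi : i = 1 ∨ i = 2) :
    p2 i m n = b2 i m n := by
  have hi' : i - 1 ≤ 1 := by omega
  have hp : p2 i m n = (oddGapSet (i - 1) (2 * m) m ∩ {s | s.sum = n}).ncard := by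
    refine card_partition_eq_ncard (P := fun s => s.card = m ∧ s.count 1 ≤ i - 1 ∧
      (∀ x ∈ s, Even x → 2 * m ≤ x) ∧
      GapCond ((s.filter fun x => ¬ Even x).sort (· ≤ ·)) 2 4) fun s => ?_
    rw [gapCond_sort_odd_two_four_iff]
    refine ⟨fun hs => ⟨fun h0 => ?_, hs⟩, fun hs => hs.2⟩
    have h1 := hs.2.2.1 0 h0 Even.zero
    have h2 := Multiset.card_pos_iff_exists_mem.2 ⟨0, h0⟩
    rw [hs.1] at h2
    omega
  have hb : b2 i m n = (gapTwoSet (i - 1) m ∩ {s | s.sum = n}).ncard := by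
    refine card_partition_eq_ncard (P := fun s => s.card = m ∧
      GapCond (s.sort (· ≤ ·)) 1 2 ∧ s.count 1 ≤ i - 1) fun s => ?_
    rw [gapCond_sort_one_two_iff, gapTwoSet, Set.mem_ofPred_eq]
    tauto
  have h := congrArg (PowerSeries.coeff n) (sumGenFun_oddGapSet_eq hi' m)
  simp only [sumGenFun, PowerSeries.coeff_mk] at h
  rw [hp, hb]
  exact_mod_cast h
end

section
/- For all integers m ≥ 1 and n ≥ 2m - 1, p_{2,2}(m,n) - p_{2,1}(m,n) = p_{2,2}(m-1, n-2m+1); that is, the number of partitions of n with exactly m parts, exactly one part equal to 1, every even part at least 2m, and odd parts (in decreasing order) satisfying λ_{j_ℓ} - λ_{j_{ℓ+2}} ≥ 4, equals p_{2,2}(m-1, n-2m+1). -/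
/-- The multiset-level counterpart of the conditions counted by `p2 i m n`. -/
def IsP2Parts (i m n : ℕ) (s : Multiset ℕ) : Prop :=
  ((∀ x ∈ s, 0 < x) ∧ s.sum = n) ∧
    Multiset.card s = m ∧
    Multiset.count 1 s ≤ i - 1 ∧
    (∀ x ∈ s, Even x → 2 * m ≤ x) ∧
    GapCond ((s.filter (fun x => ¬ Even x)).sort (· ≤ ·)) 2 4

theorem setOf_isP2Parts_eq_image (i m n : ℕ) :
    {s | IsP2Parts i m n s} = Nat.Partition.parts '' {p : n.Partition |
      Multiset.card p.parts = m ∧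
      Multiset.count 1 p.parts ≤ i - 1 ∧
      (∀ x ∈ p.parts, Even x → 2 * m ≤ x) ∧
      GapCond p.oddParts 2 4} := by
  ext s
  constructor
  · rintro ⟨⟨hpos, hsum⟩, h⟩
    exact ⟨⟨s, fun {x} hx => hpos x hx, hsum⟩, h, rfl⟩
  · rintro ⟨p, hp, rfl⟩
    exact ⟨⟨fun x hx => p.parts_pos hx, p.parts_sum⟩, hp⟩

theorem finite_setOf_isP2Parts (i m n : ℕ) : {s | IsP2Parts i m n s}.Finite := by
  rw [setOf_isP2Parts_eq_image]
  exact (Set.toFinite _).image _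

theorem p2_eq_ncard (i m n : ℕ) : p2 i m n = {s | IsP2Parts i m n s}.ncard := by
  rw [setOf_isP2Parts_eq_image,
    Set.ncard_image_of_injective _ (fun p q h => Nat.Partition.ext h)]
  rfl

/-- Shift every part up by two and adjoin a part equal to one. -/
def consOneMapAddTwo (s : Multiset ℕ) : Multiset ℕ := 1 ::ₘ s.map (· + 2)

theorem consOneMapAddTwo_injective : Function.Injective consOneMapAddTwo := fun _ _ h =>
  Multiset.map_injective (add_left_injective 2) ((Multiset.cons_inj_right 1).1 h)

theorem gapCond_cons_one_map_add_two {L : List ℕ} (hL : L.Pairwise (· ≤ ·))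
    (hodd : ∀ x ∈ L, ¬ Even x) :
    GapCond (1 :: L.map (· + 2)) 2 4 ↔ GapCond L 2 4 ∧ L.count 1 ≤ 1 := by
  have hstep : GapCond (1 :: L.map (· + 2)) 2 4 ↔
      GapCond L 2 4 ∧ (1 < L.length → 3 ≤ L[1]!) := by
    constructor
    · intro h
      refine ⟨fun l hl => ?_, fun hl => ?_⟩
      · have h1 := h (l + 1) (by simpa using by omega)
        have hl' : l < L.length := by omega
        simp [hl, hl'] at h1 ⊢
        omega
      · have h1 := h 0 (by simpa using by omega)
        simp [hl] at h1 ⊢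
        omega
    · rintro ⟨h, h0⟩ l hl
      simp only [List.length_cons, List.length_map] at hl
      cases l with
      | zero =>
        have hl' : 1 < L.length := by omega
        have h1 := h0 hl'
        simp [hl'] at h1 ⊢
        omega
      | succ l =>
        have hl1 : l + 2 < L.length := by omega
        have hl2 : l < L.length := by omega
        have h1 := h l hl1
        simp [hl1, hl2] at h1 ⊢
        omega
  rw [hstep]
  refine and_congr_right fun _ => ?_
  match L, hL, hodd with
  | [], _, _ => simp
  | [a], _, _ => simpa using List.count_le_length (a := 1) (l := [a])
  | a :: b :: L, hL, hodd =>
    simp only [List.pairwise_cons, List.mem_cons, forall_eq_or_imp] at hL hodd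
    obtain ⟨⟨hab, -⟩, hb, -⟩ := hL
    obtain ⟨ha', hb', -⟩ := hodd
    rw [Nat.even_iff] at ha' hb'
    simp only [List.length_cons, List.count_cons, beq_iff_eq]
    constructor
    · intro h
      have h3 : 3 ≤ b := by simpa using h
      have : L.count 1 = 0 := List.count_eq_zero.2 fun h1 => by
        have := hb 1 h1
        omega
      split_ifs <;> omega
    · intro h _
      have : 3 ≤ b := by
        split_ifs at h <;> omega
      simpa using this

theorem sort_filter_consOneMapAddTwo (s : Multiset ℕ) :
    ((consOneMapAddTwo s).filter (fun x => ¬ Even x)).sort (· ≤ ·) =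
      1 :: ((s.filter (fun x => ¬ Even x)).sort (· ≤ ·)).map (· + 2) := by
  have hfilter : (consOneMapAddTwo s).filter (fun x => ¬ Even x) =
      1 ::ₘ (s.filter (fun x => ¬ Even x)).map (· + 2) := by
    rw [consOneMapAddTwo, Multiset.filter_cons_of_pos _ (by decide), Multiset.filter_map]
    congr 2
    refine Multiset.filter_congr fun x _ => ?_
    simp only [Function.comp_apply, Nat.even_add, even_two, iff_true]
  rw [hfilter, Multiset.sort_cons, Multiset.map_sort (r := (· ≤ ·)) (r' := (· ≤ ·))]
  · simp
  · simp only [Multiset.mem_map]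
    rintro _ ⟨x, -, rfl⟩
    omega

theorem gapCond_consOneMapAddTwo (s : Multiset ℕ) :
    GapCond (((consOneMapAddTwo s).filter (fun x => ¬ Even x)).sort (· ≤ ·)) 2 4 ↔
      GapCond ((s.filter (fun x => ¬ Even x)).sort (· ≤ ·)) 2 4 ∧ s.count 1 ≤ 1 := by
  rw [sort_filter_consOneMapAddTwo, gapCond_cons_one_map_add_two (Multiset.pairwise_sort _ _)
    (by simp), ← Multiset.coe_count, Multiset.sort_eq,
    Multiset.count_filter_of_pos (by decide)]

theorem count_one_consOneMapAddTwo {s : Multiset ℕ} : (consOneMapAddTwo s).count 1 = 1 := by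
  simp [consOneMapAddTwo]

theorem sum_consOneMapAddTwo (s : Multiset ℕ) :
    (consOneMapAddTwo s).sum = s.sum + 2 * Multiset.card s + 1 := by
  simp [consOneMapAddTwo, Multiset.sum_map_add]
  omega

theorem isP2Parts_consOneMapAddTwo {m n : ℕ} (hm : 1 ≤ m) (hn : 2 * m - 1 ≤ n)
    {s : Multiset ℕ} :
    IsP2Parts 2 m n (consOneMapAddTwo s) ↔ IsP2Parts 2 (m - 1) (n + 1 - 2 * m) s := by
  have hcard : Multiset.card (consOneMapAddTwo s) = Multiset.card s + 1 := by
    simp [consOneMapAddTwo]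
  have hmem (P : ℕ → Prop) : (∀ x ∈ consOneMapAddTwo s, P x) ↔ P 1 ∧ ∀ x ∈ s, P (x + 2) := by
    simp [consOneMapAddTwo]
  simp only [IsP2Parts, gapCond_consOneMapAddTwo, count_one_consOneMapAddTwo,
    sum_consOneMapAddTwo, hcard, hmem]
  constructor
  · rintro ⟨⟨-, hsum⟩, hc, -, ⟨-, heven⟩, hgap, hcount⟩
    refine ⟨⟨fun x hx => ?_, by omega⟩, by omega, hcount, fun x hx hxe => ?_, hgap⟩
    · have h1 := Multiset.card_pos_iff_exists_mem.2 ⟨x, hx⟩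
      have h2 := heven x hx
      by_contra h0
      obtain rfl : x = 0 := by omega
      have := h2 (by decide)
      omega
    · have := heven x hx (by simpa [Nat.even_add] using hxe)
      omega
  · rintro ⟨⟨-, hsum⟩, hc, hcount, heven, hgap⟩
    refine ⟨⟨⟨by omega, fun x _ => by omega⟩, by omega⟩, by omega, le_rfl,
      ⟨fun h => absurd h (by decide), fun x hx hxe => ?_⟩, hgap, hcount⟩
    have := heven x hx (by simpa [Nat.even_add] using hxe)
    omega

theorem exists_eq_consOneMapAddTwo {s : Multiset ℕ} (hpos : ∀ x ∈ s, 0 < x)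
    (hcount : s.count 1 = 1) : ∃ t, consOneMapAddTwo t = s := by
  obtain ⟨t, rfl⟩ := Multiset.exists_cons_of_mem (Multiset.count_pos.1 (by omega : 0 < s.count 1))
  have ht : 1 ∉ t := Multiset.count_eq_zero.1 (by simpa using hcount)
  refine ⟨t.map (· - 2), ?_⟩
  rw [consOneMapAddTwo, Multiset.map_map]
  congr 1
  refine (Multiset.map_congr rfl fun x hx => ?_).trans t.map_id
  have h0 := hpos x (Multiset.mem_cons_of_mem hx)
  have h1 : x ≠ 1 := fun h => ht (h ▸ hx)
  simp only [Function.comp_apply, id]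
  omega

theorem setOf_isP2Parts_diff {m n : ℕ} (hm : 1 ≤ m) (hn : 2 * m - 1 ≤ n) :
    {s | IsP2Parts 2 m n s} \ {s | IsP2Parts 1 m n s} =
      consOneMapAddTwo '' {s | IsP2Parts 2 (m - 1) (n + 1 - 2 * m) s} := by
  ext s
  constructor
  · rintro ⟨h2, h1⟩
    have hcount : s.count 1 = 1 := by
      refine le_antisymm h2.2.2.1 (Nat.one_le_iff_ne_zero.2 fun h => h1 ?_)
      exact ⟨h2.1, h2.2.1, h.le, h2.2.2.2⟩
    obtain ⟨t, rfl⟩ := exists_eq_consOneMapAddTwo h2.1.1 hcount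
    exact ⟨t, (isP2Parts_consOneMapAddTwo hm hn).1 h2, rfl⟩
  · rintro ⟨t, ht, rfl⟩
    refine ⟨(isP2Parts_consOneMapAddTwo hm hn).2 ht, fun h => ?_⟩
    have := h.2.2.1
    rw [count_one_consOneMapAddTwo] at this
    omega

/-- For `m ≥ 1` and `n ≥ 2m - 1`,
`p_{2,2}(m,n) - p_{2,1}(m,n) = p_{2,2}(m-1, n-2m+1)`. -/
theorem p2_recursion_diff (m n : ℕ) (hm : 1 ≤ m) (hn : 2 * m - 1 ≤ n) :
    p2 2 m n - p2 1 m n = p2 2 (m - 1) (n + 1 - 2 * m) := by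
  have hsub : {s | IsP2Parts 1 m n s} ⊆ {s | IsP2Parts 2 m n s} := fun s h =>
    ⟨h.1, h.2.1, h.2.2.1.trans (by omega), h.2.2.2⟩
  rw [p2_eq_ncard, p2_eq_ncard, p2_eq_ncard,
    ← Set.ncard_sdiff hsub (finite_setOf_isP2Parts 1 m n), setOf_isP2Parts_diff hm hn,
    Set.ncard_image_of_injective _ consOneMapAddTwo_injective]
end

section
/- For all integers m ≥ 1 and n ≥ 2m - 1, b_{2,2}(m,n) - b_{2,1}(m,n) = b_{2,2}(m-1, n-2m+1); that is, the number of partitions of n with exactly m parts, any two parts differing by at least 2, and exactly one part equal to 1, equals b_{2,2}(m-1, n-2m+1). -/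
theorem gapCond_one_two_iff_pairwise (L : List ℕ) :
    GapCond L 1 2 ↔ L.Pairwise (fun a b => a + 2 ≤ b) := by
  have : IsTrans ℕ (fun a b => a + 2 ≤ b) := ⟨fun a b c h₁ h₂ => by omega⟩
  rw [← List.isChain_iff_pairwise, List.isChain_iff_getElem]
  refine forall_congr' fun i => ?_
  refine forall_congr' fun hi => ?_
  rw [getElem!_pos L (i + 1) hi, getElem!_pos L i (by omega)]
  omega

theorem pairwise_sort_cons_one_map_add_two {t : Multiset ℕ} :
    ((1 ::ₘ t.map (· + 2)).sort (· ≤ ·)).Pairwise (fun a b => a + 2 ≤ b) ↔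
      (∀ b ∈ t, 1 ≤ b) ∧ (t.sort (· ≤ ·)).Pairwise (fun a b => a + 2 ≤ b) := by
  have hsort : (t.map (· + 2)).sort (· ≤ ·) = (t.sort (· ≤ ·)).map (· + 2) :=
    (Multiset.map_sort _ _ _ _ (by simp)).symm
  rw [Multiset.sort_cons 1 (t.map (· + 2)) (· ≤ ·) (by simp),
    hsort, List.pairwise_cons, List.pairwise_map]
  simp

theorem count_le_one_of_pairwise_sort {s : Multiset ℕ}
    (h : (s.sort (· ≤ ·)).Pairwise (fun a b => a + 2 ≤ b)) (a : ℕ) : s.count a ≤ 1 := by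
  have hnd : (s.sort (· ≤ ·)).Nodup := h.imp (by omega)
  rw [← Multiset.coe_nodup, Multiset.sort_eq] at hnd
  exact Multiset.nodup_iff_count_le_one.mp hnd a

/-- A multiset with `2`-separated entries, all positive and one of them equal to `1`, arises from
a multiset of positive numbers by adding `2` to every entry and adjoining `1`. -/
theorem exists_eq_cons_one_map_add_two {s : Multiset ℕ} (hpos : ∀ a ∈ s, 0 < a) (h1 : 1 ∈ s)
    (h : (s.sort (· ≤ ·)).Pairwise (fun a b => a + 2 ≤ b)) :
    ∃ t : Multiset ℕ, s = 1 ::ₘ t.map (· + 2) := by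
  obtain ⟨u, rfl⟩ := Multiset.exists_cons_of_mem h1
  rw [Multiset.sort_cons 1 u (· ≤ ·) fun b hb => hpos b (Multiset.mem_cons_of_mem hb),
    List.pairwise_cons] at h
  refine ⟨u.map (· - 2), ?_⟩
  rw [Multiset.map_map]
  congr 1
  conv_lhs => rw [← Multiset.map_id u]
  refine Multiset.map_congr rfl fun b hb => ?_
  have := h.1 b (by simpa using hb)
  simp only [id, Function.comp]
  omega

/-- Adding `2` to every part and adjoining a part `1`. -/
def Nat.Partition.consOneAddTwo {k n : ℕ} (q : k.Partition)
    (h : 1 + (k + 2 * Multiset.card q.parts) = n) : n.Partition where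
  parts := 1 ::ₘ q.parts.map (· + 2)
  parts_pos := by
    intro i hi
    simp only [Multiset.mem_cons, Multiset.mem_map] at hi
    omega
  parts_sum := by
    simp only [Multiset.sum_cons, Multiset.sum_map_add, Multiset.map_id', q.parts_sum,
      Multiset.map_const', Multiset.sum_replicate, smul_eq_mul]
    omega

/-- Partitions of `n` into `m` parts, pairwise at least `2` apart, exactly one of them `1`. -/
theorem card_count_one_eq (m n : ℕ) (hm : 1 ≤ m) (hn : 2 * m - 1 ≤ n) :
    Nat.card {p : n.Partition // Multiset.card p.parts = m ∧ GapCond p.sortedParts 1 2 ∧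
      Multiset.count 1 p.parts = 1} = b2 2 (m - 1) (n + 1 - 2 * m) := by
  symm
  refine Nat.card_eq_of_bijective (fun q => ⟨q.1.consOneAddTwo ?_, ?_, ?_, ?_⟩) ⟨?_, ?_⟩
  · rw [q.2.1]
    omega
  · simp only [Nat.Partition.consOneAddTwo, Multiset.card_cons, Multiset.card_map, q.2.1]
    omega
  · rw [gapCond_one_two_iff_pairwise]
    exact pairwise_sort_cons_one_map_add_two.mpr
      ⟨fun _ => q.1.parts_pos, (gapCond_one_two_iff_pairwise _).mp q.2.2.1⟩
  · simp [Nat.Partition.consOneAddTwo]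
  · intro q q' h
    have h' : 1 ::ₘ q.1.parts.map (· + 2) = 1 ::ₘ q'.1.parts.map (· + 2) :=
      congrArg (fun p => p.1.parts) h
    rw [Multiset.cons_inj_right] at h'
    exact Subtype.ext (Nat.Partition.ext
      (Multiset.map_injective (add_left_injective 2) h'))
  · rintro ⟨p, hcard, hgap, hcount⟩
    rw [gapCond_one_two_iff_pairwise] at hgap
    obtain ⟨t, ht⟩ := exists_eq_cons_one_map_add_two (fun _ => p.parts_pos)
      (Multiset.count_pos.mp (by omega)) hgap
    rw [Nat.Partition.sortedParts, ht, pairwise_sort_cons_one_map_add_two] at hgap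
    have hsum := p.parts_sum
    rw [ht, Multiset.card_cons, Multiset.card_map] at hcard
    simp only [ht, Multiset.sum_cons, Multiset.sum_map_add, Multiset.map_id',
      Multiset.map_const', Multiset.sum_replicate, smul_eq_mul] at hsum
    refine ⟨⟨⟨t, fun {i} hi => hgap.1 i hi, by omega⟩, by simp only; omega,
      (gapCond_one_two_iff_pairwise _).mpr hgap.2, count_le_one_of_pairwise_sort hgap.2 1⟩, ?_⟩
    exact Subtype.ext (Nat.Partition.ext ht.symm)

theorem b2_two_eq_add (m n : ℕ) :
    b2 2 m n = Nat.card {p : n.Partition // Multiset.card p.parts = m ∧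
      GapCond p.sortedParts 1 2 ∧ Multiset.count 1 p.parts = 1} + b2 1 m n := by
  classical
  simp only [b2, Nat.card_eq_fintype_card, Fintype.card_subtype]
  rw [← Finset.card_union_of_disjoint, ← Finset.filter_or]
  · congr 1
    ext p
    simp only [Finset.mem_filter, Finset.mem_univ, true_and, ← and_or_left]
    refine and_congr_right fun _ => and_congr_right fun _ => ?_
    omega
  · rw [Finset.disjoint_filter]
    omega

/-- For `m ≥ 1` and `n ≥ 2m - 1`,
`b_{2,2}(m,n) - b_{2,1}(m,n) = b_{2,2}(m-1, n-2m+1)`. -/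
theorem b2_recursion_diff (m n : ℕ) (hm : 1 ≤ m) (hn : 2 * m - 1 ≤ n) :
    b2 2 m n - b2 1 m n = b2 2 (m - 1) (n + 1 - 2 * m) := by
  rw [b2_two_eq_add, Nat.add_sub_cancel, card_count_one_eq m n hm hn]
end

section
/- For all integers m ≥ 1 and n ≥ 2m, b_{2,1}(m,n) = b_{2,1}(m-1, n-2m) + b_{2,2}(m, n-2m), where b_{2,i}(m,n) counts partitions of n with exactly m parts, any two parts differing by at least 2, and at most i-1 parts equal to 1. -/
/-- Lists of `m` naturals, all at least `k`, with sum `n`, each entry exceeding all the previous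
ones by at least `2`. -/
def gapLists (k m n : ℕ) : Set (List ℕ) :=
  {L | L.Pairwise (fun a b => a + 2 ≤ b) ∧ (∀ x ∈ L, k ≤ x) ∧ L.length = m ∧ L.sum = n}

theorem sort_coe_of_pairwise_gap {L : List ℕ} (h : L.Pairwise (fun a b => a + 2 ≤ b)) :
    (L : Multiset ℕ).sort (· ≤ ·) = L := by
  apply List.Perm.eq_of_pairwise' (r := (· ≤ ·)) (Multiset.pairwise_sort _ _)
    (h.imp fun hab => by omega)
  rw [← Multiset.coe_eq_coe, Multiset.sort_eq]

theorem b2_eq_card_lists (i m n : ℕ) :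
    b2 i m n = {L | L ∈ gapLists 1 m n ∧ L.count 1 ≤ i - 1}.ncard := by
  rw [← Nat.card_coe_set_eq]
  refine Nat.card_congr
    { toFun := fun p => ⟨p.1.sortedParts, ?_⟩
      invFun := fun L => ⟨⟨L.1, fun hx => L.2.1.2.1 _ hx, by simpa using L.2.1.2.2.2⟩, ?_⟩
      left_inv := ?_
      right_inv := ?_ }
  · obtain ⟨p, hm, hg, hc⟩ := p
    have hs : (p.sortedParts : Multiset ℕ) = p.parts := Multiset.sort_eq _ _
    refine ⟨⟨(gapCond_one_two_iff_pairwise _).1 hg, fun x hx => ?_, ?_, ?_⟩, ?_⟩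
    · exact p.parts_pos (by rwa [← hs, Multiset.mem_coe])
    · rw [← Multiset.coe_card, hs, hm]
    · rw [← Multiset.sum_coe, hs, p.parts_sum]
    · rwa [← Multiset.coe_count, hs]
  · obtain ⟨L, ⟨hp, hk, hm, hn⟩, hc⟩ := L
    refine ⟨by simpa using hm, ?_, by simpa using hc⟩
    rw [gapCond_one_two_iff_pairwise]
    unfold Nat.Partition.sortedParts
    rwa [sort_coe_of_pairwise_gap hp]
  · rintro ⟨p, hp⟩
    exact Subtype.ext (Nat.Partition.ext (Multiset.sort_eq _ _))
  · rintro ⟨L, hL⟩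
    exact Subtype.ext (sort_coe_of_pairwise_gap hL.1.1)

theorem b2_one_eq_ncard_gapLists (m n : ℕ) : b2 1 m n = (gapLists 2 m n).ncard := by
  rw [b2_eq_card_lists]
  congr 1
  ext L
  simp only [gapLists, Set.mem_ofPred_eq, Nat.sub_self, Nat.le_zero, List.count_eq_zero]
  constructor
  · rintro ⟨⟨hp, hk, h⟩, h1⟩
    refine ⟨hp, fun x hx => ?_, h⟩
    have := hk x hx
    have : x ≠ 1 := fun e => h1 (e ▸ hx)
    omega
  · rintro ⟨hp, hk, h⟩
    exact ⟨⟨hp, fun x hx => by have := hk x hx; omega, h⟩, fun h1 => by have := hk 1 h1; omega⟩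

theorem b2_two_eq_ncard_gapLists (m n : ℕ) : b2 2 m n = (gapLists 1 m n).ncard := by
  rw [b2_eq_card_lists]
  congr 1
  ext L
  refine ⟨fun h => h.1, fun h => ⟨h, ?_⟩⟩
  exact List.nodup_iff_count_le_one.1 (h.1.imp fun hab => by omega) 1

theorem gapLists_finite (k m n : ℕ) : (gapLists k m n).Finite := by
  refine ((List.finite_length_eq (Fin (n + 1)) m).image (List.map Fin.val)).subset ?_
  rintro L ⟨-, -, hm, hn⟩
  have hlt : ∀ x ∈ L, x < n + 1 := fun x hx => by
    have := List.single_le_sum (fun y _ => Nat.zero_le y) x hx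
    omega
  refine ⟨L.pmap Fin.mk hlt, by simpa using hm, ?_⟩
  simp [List.map_pmap]

theorem sum_map_add_two (L : List ℕ) : (L.map (· + 2)).sum = L.sum + 2 * L.length := by
  induction L with
  | nil => rfl
  | cons a L ih => simp only [List.map_cons, List.sum_cons, List.length_cons, ih]; ring

theorem gapLists_add_two (m n : ℕ) :
    gapLists 2 m (n + 2 * m) = List.map (· + 2) '' gapLists 0 m n := by
  ext L
  constructor
  · rintro ⟨hp, hk, hm, hn⟩
    have hL : (L.map (· - 2)).map (· + 2) = L := by
      rw [List.map_map]
      exact (List.map_congr_left fun x hx => Nat.sub_add_cancel (hk x hx)).trans (List.map_id _)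
    refine ⟨L.map (· - 2), ⟨?_, fun x _ => Nat.zero_le x, by simpa using hm, ?_⟩, hL⟩
    · rw [List.pairwise_map]
      refine hp.imp_of_mem fun {a b} ha hb hab => ?_
      have := hk a ha
      omega
    · have := sum_map_add_two (L.map (· - 2))
      rw [hL, hn, List.length_map, hm] at this
      omega
  · rintro ⟨L, ⟨hp, -, hm, hn⟩, rfl⟩
    refine ⟨?_, ?_, by simpa using hm, by rw [sum_map_add_two, hm, hn]⟩
    · rw [List.pairwise_map]
      exact hp.imp fun hab => by omega
    · intro x hx
      obtain ⟨y, -, rfl⟩ := List.mem_map.1 hx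
      exact Nat.le_add_left 2 y

theorem gapLists_zero_succ (m n : ℕ) :
    gapLists 0 (m + 1) n = List.cons 0 '' gapLists 2 m n ∪ gapLists 1 (m + 1) n := by
  ext L
  constructor
  · rintro ⟨hp, -, hm, hn⟩
    obtain _ | ⟨a, L⟩ := L
    · simp at hm
    rw [List.pairwise_cons] at hp
    obtain rfl | ha := Nat.eq_zero_or_pos a
    · exact Or.inl ⟨L, ⟨hp.2, fun x hx => by simpa using hp.1 x hx, by simpa using hm,
        by simpa using hn⟩, rfl⟩
    · refine Or.inr ⟨List.pairwise_cons.2 hp, fun x hx => ?_, hm, hn⟩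
      obtain rfl | hx := List.mem_cons.1 hx
      · exact ha
      · have := hp.1 x hx
        omega
  · rintro (⟨L, ⟨hp, hk, hm, hn⟩, rfl⟩ | ⟨hp, hk, h⟩)
    · exact ⟨List.pairwise_cons.2 ⟨fun x hx => by simpa using hk x hx, hp⟩,
        fun x _ => Nat.zero_le x, by simpa using hm, by simpa using hn⟩
    · exact ⟨hp, fun x _ => Nat.zero_le x, h⟩

/-- For `m ≥ 1` and `n ≥ 2m`,
`b_{2,1}(m,n) = b_{2,1}(m-1, n-2m) + b_{2,2}(m, n-2m)`. -/
theorem b2_recursion_sum (m n : ℕ) (hm : 1 ≤ m) (hn : 2 * m ≤ n) :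
    b2 1 m n = b2 1 (m - 1) (n - 2 * m) + b2 2 m (n - 2 * m) := by
  obtain ⟨n, rfl⟩ := Nat.exists_eq_add_of_le' hn
  obtain ⟨m, rfl⟩ := Nat.exists_eq_add_of_le' hm
  have hdisj : Disjoint (List.cons 0 '' gapLists 2 m n) (gapLists 1 (m + 1) n) := by
    rw [Set.disjoint_left]
    rintro _ ⟨L, -, rfl⟩ ⟨-, hk, -⟩
    exact absurd (hk 0 List.mem_cons_self) (by omega)
  rw [Nat.add_sub_cancel, Nat.add_sub_cancel, b2_one_eq_ncard_gapLists, b2_one_eq_ncard_gapLists,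
    b2_two_eq_ncard_gapLists, gapLists_add_two,
    Set.ncard_image_of_injective _ (List.map_injective_iff.2 (add_left_injective 2)),
    gapLists_zero_succ,
    Set.ncard_union_eq hdisj ((gapLists_finite _ _ _).image _) (gapLists_finite _ _ _),
    Set.ncard_image_of_injective _ List.cons_injective]
end
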